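/- arXiv:2505.10005 — 2 statements merged into one kernel-verified Lean document; each statement's English description precedes it below -/
import Mathlib

section
/- Every jump game whose graph is an m_1 × m_2 torus (the Cartesian product of the cycles C_{m_1} and C_{m_2}) with m_1 ≥ m_2 ≥ 9, whose n < m_1·m_2 agents are partitioned into k ≥ 3 types, and whose largest type contains at least 8 agents, admits an equilibrium assignment. -/
open Finset

variable {V : Type*} {A : Type*} {T : Type*}

/-- Utility of agent `i` under assignment `σ`: the number of distinct types,
different from `t i`, among the agents occupying nodes adjacent to `σ i`. -/
noncomputable def util (G : SimpleGraph V) (t : A → T) (σ : A ↪ V) (i : A) : ℕ :=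
  {c : T | c ≠ t i ∧ ∃ j : A, G.Adj (σ i) (σ j) ∧ t j = c}.ncard

/-- Type-count of node `w` under assignment `σ`: the number of distinct types
among the agents occupying nodes adjacent to `w`. -/
noncomputable def tauN (G : SimpleGraph V) (t : A → T) (σ : A ↪ V) (w : V) : ℕ :=
  {c : T | ∃ j : A, G.Adj w (σ j) ∧ t j = c}.ncard

/-- A node is empty under `σ` if no agent occupies it. -/
def IsEmptyNode (σ : A ↪ V) (w : V) : Prop := ∀ i : A, σ i ≠ w

/-- `σ'` is obtained from `σ` by an improving jump of agent `i`. -/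
def ImpJump (G : SimpleGraph V) (t : A → T) (σ σ' : A ↪ V) (i : A) : Prop :=
  (∀ j : A, j ≠ i → σ' j = σ j) ∧ IsEmptyNode σ (σ' i) ∧
    util G t σ i < util G t σ' i

/-- An assignment is an equilibrium if no agent has an improving jump. -/
def IsEquilibrium (G : SimpleGraph V) (t : A → T) (σ : A ↪ V) : Prop :=
  ∀ (σ' : A ↪ V) (i : A), ¬ ImpJump G t σ σ' i

/-- An improving response cycle: `f 0, f 1, …, f m` with `m ≥ 1`, `f m = f 0`,
and each step an improving jump of some agent. -/
def IsIRC (G : SimpleGraph V) (t : A → T) (m : ℕ) (f : ℕ → (A ↪ V)) : Prop :=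
  1 ≤ m ∧ f m = f 0 ∧ ∀ ℓ < m, ∃ i : A, ImpJump G t (f ℓ) (f (ℓ + 1)) i

/-- Social welfare: total utility of the agents. -/
noncomputable def socialWelfare [Fintype A] (G : SimpleGraph V) (t : A → T) (σ : A ↪ V) : ℕ :=
  ∑ i : A, util G t σ i

/-- Number of colorful edges: edges whose endpoints are occupied by agents of
different types. -/
noncomputable def colorfulEdges (G : SimpleGraph V) (t : A → T) (σ : A ↪ V) : ℕ :=
  {e ∈ G.edgeSet | ∃ i j : A, t i ≠ t j ∧ e = s(σ i, σ j)}.ncard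

/-- The set of monochromatic edges: edges whose endpoints are occupied by agents
of the same type. -/
def monoEdgeSet (G : SimpleGraph V) (t : A → T) (σ : A ↪ V) : Set (Sym2 V) :=
  {e ∈ G.edgeSet | ∃ i j : A, i ≠ j ∧ t i = t j ∧ e = s(σ i, σ j)}

/-- Number of monochromatic edges. -/
noncomputable def monoEdges (G : SimpleGraph V) (t : A → T) (σ : A ↪ V) : ℕ :=
  (monoEdgeSet G t σ).ncard

/-- `c(σ)`: the number of empty nodes adjacent to at most one type of agents. -/
noncomputable def emptyLowCount (G : SimpleGraph V) (t : A → T) (σ : A ↪ V) : ℕ :=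
  {w : V | IsEmptyNode σ w ∧ tauN G t σ w ≤ 1}.ncard

/-- `TE(σ)`: the total type-count of the empty nodes. -/
noncomputable def totalEmptyTypeCount (G : SimpleGraph V) (t : A → T) (σ : A ↪ V) : ℕ :=
  ∑ᶠ w ∈ {w : V | IsEmptyNode σ w}, tauN G t σ w

open Classical in
/-- `B(σ)`: 1 if two (distinct) empty nodes are adjacent, 0 otherwise. -/
noncomputable def adjEmptyIndicator (G : SimpleGraph V) (σ : A ↪ V) : ℕ :=
  if ∃ w₁ w₂ : V, IsEmptyNode σ w₁ ∧ IsEmptyNode σ w₂ ∧ G.Adj w₁ w₂ then 1 else 0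

/-- `n_T`: the number of agents of type `c`. -/
noncomputable def typeCount (t : A → T) (c : T) : ℕ := {i : A | t i = c}.ncard

/-- The m₁ × m₂ torus graph: the Cartesian product of the cycles `C_{m₁}` and
`C_{m₂}`. -/
def torusGraph (m₁ m₂ : ℕ) : SimpleGraph (ZMod m₁ × ZMod m₂) :=
  SimpleGraph.fromRel (fun p q =>
    (p.1 = q.1 + 1 ∧ p.2 = q.2) ∨ (p.1 = q.1 ∧ p.2 = q.2 + 1))


/-- Adjacency in the cycle on `0, …, m - 1`. -/
def jgCyc (m a b : ℕ) : Prop :=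
  b = a + 1 ∨ a = b + 1 ∨ (a = 0 ∧ b + 1 = m) ∨ (b = 0 ∧ a + 1 = m)

/-- Adjacency in the torus, in natural coordinates. -/
def jgAdj (m1 m2 : ℕ) (u v : ℕ × ℕ) : Prop :=
  (u.1 = v.1 ∧ jgCyc m2 u.2 v.2) ∨ (u.2 = v.2 ∧ jgCyc m1 u.1 v.1)

/-- A sufficient condition for being an equilibrium, in natural coordinates. -/
structure JgNG {A T : Type*} (m1 m2 : ℕ) (t : A → T) (σ : A → ℕ × ℕ) : Prop where
  inj : Function.Injective σ
  rng : ∀ i, (σ i).1 < m1 ∧ (σ i).2 < m2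
  s1 : ∀ w : ℕ × ℕ, w.1 < m1 → w.2 < m2 → (∀ i, σ i ≠ w) →
    ∀ i j, jgAdj m1 m2 w (σ i) → jgAdj m1 m2 w (σ j) → t i = t j
  s2 : ∀ i, (∃ j, jgAdj m1 m2 (σ i) (σ j) ∧ t j ≠ t i) ∨
    (∀ w : ℕ × ℕ, w.1 < m1 → w.2 < m2 → (∀ i, σ i ≠ w) →
      ∀ j, jgAdj m1 m2 w (σ j) → t j = t i)

theorem jgAdj_symm {m1 m2 : ℕ} {u v : ℕ × ℕ} (h : jgAdj m1 m2 u v) : jgAdj m1 m2 v u := by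
  unfold jgAdj jgCyc at *
  omega

theorem jgAdj_swap {m1 m2 : ℕ} {u v : ℕ × ℕ} :
    jgAdj m1 m2 u.swap v.swap ↔ jgAdj m2 m1 u v := by
  unfold jgAdj jgCyc
  simp only [Prod.fst_swap, Prod.snd_swap]
  omega

theorem jgNG_swap {A T : Type*} {m1 m2 : ℕ} {t : A → T} {σ : A → ℕ × ℕ}
    (h : JgNG m2 m1 t σ) : JgNG m1 m2 t (fun i => (σ i).swap) := by
  have key : ∀ w : ℕ × ℕ, (∀ i, (σ i).swap ≠ w) → ∀ i, σ i ≠ w.swap := by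
    intro w hw i hi
    exact hw i (by rw [hi, Prod.swap_swap])
  have kadj : ∀ (w : ℕ × ℕ) i, jgAdj m1 m2 w (σ i).swap → jgAdj m2 m1 w.swap (σ i) := by
    intro w i hi
    rw [← Prod.swap_swap w] at hi
    exact jgAdj_swap.1 hi
  refine ⟨?_, ?_, ?_, ?_⟩
  · intro i j hij
    exact h.inj (Prod.swap_injective hij)
  · intro i
    exact ⟨(h.rng i).2, (h.rng i).1⟩
  · intro w hw1 hw2 hw i j hi hj
    exact h.s1 w.swap hw2 hw1 (key w hw) i j (kadj w i hi) (kadj w j hj)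
  · intro i
    rcases h.s2 i with ⟨j, h1, h2⟩ | h'
    · exact Or.inl ⟨j, jgAdj_swap.2 h1, h2⟩
    · right
      intro w hw1 hw2 hw j hj
      exact h' w.swap hw2 hw1 (key w hw) j (kadj w j hj)

theorem jg_cast_succ {m a b : ℕ} (ha : a < m) (hb : b < m) :
    ((a : ZMod m) = (b : ZMod m) + 1) ↔ (a = b + 1 ∨ (a = 0 ∧ b + 1 = m)) := by
  have : ((b : ZMod m) + 1) = ((b + 1 : ℕ) : ZMod m) := by push_cast; rfl
  rw [this, ZMod.natCast_eq_natCast_iff, Nat.ModEq, Nat.mod_eq_of_lt ha]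
  by_cases h : b + 1 = m
  · rw [h, Nat.mod_self]; omega
  · rw [Nat.mod_eq_of_lt (by omega)]; omega

theorem jg_cast_eq {m a b : ℕ} (ha : a < m) (hb : b < m) :
    ((a : ZMod m) = (b : ZMod m)) ↔ a = b := by
  rw [ZMod.natCast_eq_natCast_iff, Nat.ModEq, Nat.mod_eq_of_lt ha, Nat.mod_eq_of_lt hb]

theorem jg_torus_adj {m1 m2 : ℕ} (h1 : 9 ≤ m1) (h2 : 9 ≤ m2) {u v : ℕ × ℕ}
    (hu : u.1 < m1 ∧ u.2 < m2) (hv : v.1 < m1 ∧ v.2 < m2) :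
    (torusGraph m1 m2).Adj ((u.1 : ZMod m1), (u.2 : ZMod m2)) ((v.1 : ZMod m1), (v.2 : ZMod m2))
      ↔ jgAdj m1 m2 u v := by
  unfold torusGraph
  rw [SimpleGraph.fromRel_adj]
  simp only [ne_eq, Prod.mk.injEq]
  rw [jg_cast_succ hu.1 hv.1, jg_cast_succ hv.1 hu.1, jg_cast_succ hu.2 hv.2,
    jg_cast_succ hv.2 hu.2, jg_cast_eq hu.1 hv.1, jg_cast_eq hu.2 hv.2, jg_cast_eq hv.1 hu.1,
    jg_cast_eq hv.2 hu.2]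
  unfold jgAdj jgCyc
  omega

theorem jg_equilibrium {A T : Type*} {m1 m2 : ℕ} (h1 : 9 ≤ m1) (h2 : 9 ≤ m2)
    [Finite T] {t : A → T} {σ : A → ℕ × ℕ} (h : JgNG m1 m2 t σ) :
    ∃ σ : A ↪ ZMod m1 × ZMod m2, IsEquilibrium (torusGraph m1 m2) t σ := by
  have : NeZero m1 := ⟨by omega⟩
  have : NeZero m2 := ⟨by omega⟩
  let τ : A ↪ ZMod m1 × ZMod m2 := ⟨fun i => (((σ i).1 : ZMod m1), ((σ i).2 : ZMod m2)), by
    intro i j hij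
    simp only [Prod.mk.injEq] at hij
    rw [jg_cast_eq (h.rng i).1 (h.rng j).1, jg_cast_eq (h.rng i).2 (h.rng j).2] at hij
    exact h.inj (Prod.ext hij.1 hij.2)⟩
  refine ⟨τ, ?_⟩
  rintro σ' i ⟨hs, he, hu⟩
  let w : ℕ × ℕ := ((σ' i).1.val, (σ' i).2.val)
  have hw1 : w.1 < m1 := ZMod.val_lt _
  have hw2 : w.2 < m2 := ZMod.val_lt _
  have hwc : σ' i = ((w.1 : ZMod m1), (w.2 : ZMod m2)) := by
    apply Prod.ext
    · simp [w]
    · simp [w]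
  have hwe : ∀ j, σ j ≠ w := by
    intro j hj
    apply he j
    rw [hwc, ← hj]
    rfl
  have hadj : ∀ j, j ≠ i → (torusGraph m1 m2).Adj (σ' i) (σ' j) → jgAdj m1 m2 w (σ j) := by
    intro j hj hA
    rw [hs j hj, hwc] at hA
    exact (jg_torus_adj h1 h2 ⟨hw1, hw2⟩ (h.rng j)).1 hA
  rcases h.s2 i with ⟨j, hj1, hj2⟩ | h'
  · have hpos : 1 ≤ util (torusGraph m1 m2) t τ i := by
      unfold util
      rw [Nat.one_le_iff_ne_zero, Ne, Set.ncard_eq_zero (Set.toFinite _)]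
      apply Set.Nonempty.ne_empty
      exact ⟨t j, hj2, j, (jg_torus_adj h1 h2 (h.rng i) (h.rng j)).2 hj1, rfl⟩
    have hle : util (torusGraph m1 m2) t σ' i ≤ 1 := by
      unfold util
      rw [Set.ncard_le_one (Set.toFinite _)]
      rintro c ⟨hc, a, ha, rfl⟩ c' ⟨hc', b, hb, rfl⟩
      exact h.s1 w hw1 hw2 hwe a b (hadj a (by rintro rfl; exact hc rfl) ha)
        (hadj b (by rintro rfl; exact hc' rfl) hb)
    omega
  · have hle : util (torusGraph m1 m2) t σ' i = 0 := by
      unfold util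
      rw [Set.ncard_eq_zero (Set.toFinite _)]
      rw [Set.eq_empty_iff_forall_notMem]
      rintro c ⟨hc, a, ha, rfl⟩
      exact hc (h' w hw1 hw2 hwe a (hadj a (by rintro rfl; exact hc rfl) ha))
    omega


open Classical in
theorem jg_island {A T : Type*} [Fintype A] (t : A → T) (r0 : T) (m1 m2 : ℕ)
    (N R : Finset (ℕ × ℕ)) (hNR : Disjoint N R)
    (hN : ∀ u ∈ N, u.1 < m1 ∧ u.2 < m2) (hR : ∀ u ∈ R, u.1 < m1 ∧ u.2 < m2)
    (cN : #N = #{a : A | t a ≠ r0}) (cR : #R = #{a : A | t a = r0})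
    (hout : ∀ u ∈ N, ∃ v ∈ R, jgAdj m1 m2 u v)
    (hnb : ∀ u ∈ N, ∀ v : ℕ × ℕ, v.1 < m1 → v.2 < m2 → jgAdj m1 m2 u v → v ∈ N ∨ v ∈ R) :
    ∃ σ : A → ℕ × ℕ, JgNG m1 m2 t σ := by
  have g1 := Finset.equivOfCardEq cN.symm
  have g2 := Finset.equivOfCardEq cR.symm
  let σ : A → ℕ × ℕ := fun a => if h : t a = r0 then g2 ⟨a, by simpa using h⟩
    else g1 ⟨a, by simpa using h⟩
  have σR : ∀ a, t a = r0 → σ a ∈ R := by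
    intro a h
    simp only [σ, h, dite_true]
    exact (g2 _).2
  have σN : ∀ a, t a ≠ r0 → σ a ∈ N := by
    intro a h
    simp only [σ, h, dite_false]
    exact (g1 _).2
  have σR' : ∀ v ∈ R, ∃ a, t a = r0 ∧ σ a = v := by
    intro v hv
    have h : t (g2.symm ⟨v, hv⟩) = r0 := by
      have := (g2.symm ⟨v, hv⟩).2
      rw [Finset.mem_filter] at this
      exact this.2
    refine ⟨g2.symm ⟨v, hv⟩, h, ?_⟩
    simp [σ, h]
  have σN' : ∀ v ∈ N, ∃ a, t a ≠ r0 ∧ σ a = v := by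
    intro v hv
    have h : t (g1.symm ⟨v, hv⟩) ≠ r0 := by
      have := (g1.symm ⟨v, hv⟩).2
      rw [Finset.mem_filter] at this
      exact this.2
    refine ⟨g1.symm ⟨v, hv⟩, h, ?_⟩
    simp [σ, h]
  have hempty : ∀ w : ℕ × ℕ, w.1 < m1 → w.2 < m2 → (∀ i, σ i ≠ w) →
      ∀ j, jgAdj m1 m2 w (σ j) → t j = r0 := by
    intro w h1 h2 hw j hj
    by_contra hne
    rcases hnb _ (σN j hne) w h1 h2 (jgAdj_symm hj) with h | h
    · obtain ⟨a, _, ha⟩ := σN' w h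
      exact hw a ha
    · obtain ⟨a, _, ha⟩ := σR' w h
      exact hw a ha
  refine ⟨σ, ?_, ?_, ?_, ?_⟩
  · intro a b hab
    by_cases ha : t a = r0 <;> by_cases hb : t b = r0
    · simp only [σ, ha, hb, dite_true] at hab
      have := g2.injective (Subtype.ext hab)
      simpa using this
    · exact absurd (hab ▸ σR a ha) (Finset.disjoint_left.1 hNR (σN b hb))
    · exact absurd (hab ▸ σR b hb) (Finset.disjoint_left.1 hNR (σN a ha))
    · simp only [σ, ha, hb, dite_false] at hab
      have := g1.injective (Subtype.ext hab)
      simpa using this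
  · intro a
    by_cases ha : t a = r0
    · exact hR _ (σR a ha)
    · exact hN _ (σN a ha)
  · intro w h1 h2 hw i j hi hj
    rw [hempty w h1 h2 hw i hi, hempty w h1 h2 hw j hj]
  · intro i
    by_cases hi : t i = r0
    · right
      intro w h1 h2 hw j hj
      rw [hi, hempty w h1 h2 hw j hj]
    · left
      obtain ⟨v, hv, hadj⟩ := hout _ (σN i hi)
      obtain ⟨a, ha, rfl⟩ := σR' v hv
      exact ⟨a, hadj, by rw [ha]; exact fun h => hi h.symm⟩

/-- Index of a cell in the double-row snake order. -/
def jgIdx (m1 : ℕ) (u : ℕ × ℕ) : ℕ := (2 * m1) * (u.2 / 3) + (2 * u.1 + (u.2 % 3 - 1))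

/-- Inverse of `jgIdx`. -/
def jgCell (m1 : ℕ) (i : ℕ) : ℕ × ℕ :=
  (i % (2 * m1) / 2, 3 * (i / (2 * m1)) + 1 + i % (2 * m1) % 2)

/-- The neighbouring cell outside the double row. -/
def jgOut (m2 : ℕ) (u : ℕ × ℕ) : ℕ × ℕ :=
  if u.2 % 3 = 1 then (u.1, u.2 - 1) else (u.1, if u.2 + 1 = m2 then 0 else u.2 + 1)

open Classical in
theorem jg_case2 {A T : Type*} [Fintype A] (t : A → T) (r0 : T) (m1 m2 : ℕ)
    (h1 : 9 ≤ m1) (h2 : 9 ≤ m2) (hn : Fintype.card A < m1 * m2)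
    (hbig : #{a : A | t a ≠ r0} + 4 ≤ #{a : A | t a = r0})
    (hpos : 1 ≤ #{a : A | t a ≠ r0}) :
    ∃ σ : A → ℕ × ℕ, JgNG m1 m2 t σ := by
  set n1 := #{a : A | t a = r0} with hn1
  set n' := #{a : A | t a ≠ r0} with hn'
  have hsum : n1 + n' = Fintype.card A := by
    rw [hn1, hn', ← Finset.card_univ, ← Finset.card_filter_add_card_filter_not
      (s := (Finset.univ : Finset A)) (fun a => t a = r0)]
  set grid : Finset (ℕ × ℕ) := Finset.range m1 ×ˢ Finset.range m2 with hgrid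
  have mgrid : ∀ u, u ∈ grid ↔ u.1 < m1 ∧ u.2 < m2 := by
    intro u; simp [hgrid]
  set N : Finset (ℕ × ℕ) := {u ∈ grid | u.2 % 3 ≠ 0 ∧ jgIdx m1 u < n'} with hNdef
  have mN : ∀ u, u ∈ N ↔ (u.1 < m1 ∧ u.2 < m2) ∧ u.2 % 3 ≠ 0 ∧ jgIdx m1 u < n' := by
    intro u; rw [hNdef, Finset.mem_filter, mgrid]
  -- rows used
  have hq : ∀ q, (2 * m1) * q < n' → 3 * q + 3 ≤ m2 := by
    intro q hq
    have : m1 * (4 * q) < m1 * m2 := by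
      have : m1 * (4 * q) = 2 * ((2 * m1) * q) := by ring
      omega
    have := Nat.lt_of_mul_lt_mul_left this
    omega
  have hcell : ∀ i < n', jgCell m1 i ∈ N ∧ jgIdx m1 (jgCell m1 i) = i := by
    intro i hi
    have hd := Nat.div_add_mod i (2 * m1)
    have hm := Nat.mod_lt i (show 0 < 2 * m1 by omega)
    have hqq := hq (i / (2 * m1)) (by omega)
    have hidx : jgIdx m1 (jgCell m1 i) = i := by
      unfold jgIdx jgCell
      simp only
      rw [show (3 * (i / (2 * m1)) + 1 + i % (2 * m1) % 2) / 3 = i / (2 * m1) by omega]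
      omega
    refine ⟨(mN _).2 ⟨⟨?_, ?_⟩, ?_, ?_⟩, hidx⟩
    · unfold jgCell; simp only; omega
    · unfold jgCell; simp only; omega
    · unfold jgCell; simp only; omega
    · omega
  have cN : #N = n' := by
    rw [← Finset.card_range n']
    symm
    apply Finset.card_nbij' (jgCell m1) (jgIdx m1)
    · intro i hi
      exact (hcell i (by simpa using hi)).1
    · intro u hu
      simpa using ((mN u).1 hu).2.2
    · intro i hi
      exact (hcell i (by simpa using hi)).2
    · intro u hu
      obtain ⟨⟨hu1, hu2⟩, hu3, hu4⟩ := (mN u).1 hu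
      unfold jgCell jgIdx
      have ha : (2 * m1 * (u.2 / 3) + (2 * u.1 + (u.2 % 3 - 1))) / (2 * m1) = u.2 / 3 := by
        rw [Nat.mul_add_div (by omega), Nat.div_eq_of_lt (show 2 * u.1 + (u.2 % 3 - 1) < 2 * m1 by omega), add_zero]
      have hb : (2 * m1 * (u.2 / 3) + (2 * u.1 + (u.2 % 3 - 1))) % (2 * m1) =
          2 * u.1 + (u.2 % 3 - 1) := by
        rw [Nat.mul_add_mod, Nat.mod_eq_of_lt (by omega)]
      rw [ha, hb]
      apply Prod.ext
      · simp only; omega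
      · simp only; omega
  set j0 := (n' - 1) / (2 * m1) with hj0
  set s0 := (n' - 1) % (2 * m1) with hs0
  have hd0 : 2 * m1 * j0 + s0 = n' - 1 := Nat.div_add_mod _ _
  have hs0lt : s0 < 2 * m1 := Nat.mod_lt _ (by omega)
  set X : Finset (ℕ × ℕ) := {(s0 / 2 + 1, 3 * j0 + 1),
    (if s0 % 2 = 0 then s0 / 2 else s0 / 2 + 1, 3 * j0 + 2),
    (m1 - 1, 3 * j0 + 1), (m1 - 1, 3 * j0 + 2)} with hX
  set E : Finset (ℕ × ℕ) := {u ∈ N.image (jgOut m2) ∪ X | u ∈ grid ∧ u ∉ N} with hE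
  have cE : #E ≤ n1 := by
    have a1 : #E ≤ #(N.image (jgOut m2) ∪ X) := Finset.card_filter_le _ _
    have a2 : #(N.image (jgOut m2) ∪ X) ≤ #(N.image (jgOut m2)) + #X := Finset.card_union_le _ _
    have a3 : #(N.image (jgOut m2)) ≤ #N := Finset.card_image_le
    have a4 : #X ≤ 4 := Finset.card_le_four
    omega
  have hNg : N ⊆ grid := Finset.filter_subset _ _
  obtain ⟨R, hER, hRg, cR⟩ : ∃ R, E ⊆ R ∧ R ⊆ grid \ N ∧ #R = n1 := by
    apply Finset.exists_subsuperset_card_eq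
    · intro u hu
      rw [hE, Finset.mem_filter] at hu
      rw [Finset.mem_sdiff]
      exact hu.2
    · exact cE
    · rw [Finset.card_sdiff_of_subset hNg, cN]
      have : #grid = m1 * m2 := by simp [hgrid]
      omega
  refine jg_island t r0 m1 m2 N R ?_ ?_ ?_ cN cR ?_ ?_
  · rw [Finset.disjoint_right]
    intro u hu
    exact (Finset.mem_sdiff.1 (hRg hu)).2
  · intro u hu; exact ((mN u).1 hu).1
  · intro u hu; exact (mgrid u).1 (Finset.mem_sdiff.1 (hRg hu)).1
  · intro u hu
    obtain ⟨⟨hu1, hu2⟩, hu3, hu4⟩ := (mN u).1 hu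
    have hlt : 2 * m1 * (u.2 / 3) < n' := by unfold jgIdx at hu4; omega
    have hqq := hq _ hlt
    have hadj : jgAdj m1 m2 u (jgOut m2 u) ∧ (jgOut m2 u).1 < m1 ∧ (jgOut m2 u).2 < m2 ∧
        (jgOut m2 u).2 % 3 = 0 := by
      unfold jgOut jgAdj jgCyc
      split_ifs <;> refine ⟨Or.inl ⟨rfl, ?_⟩, ?_, ?_, ?_⟩ <;> simp only [true_and, true_or] <;> omega
    refine ⟨jgOut m2 u, hER ?_, hadj.1⟩
    rw [hE, Finset.mem_filter]
    refine ⟨Finset.mem_union_left _ (Finset.mem_image_of_mem _ hu), ?_, ?_⟩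
    · rw [mgrid]; exact ⟨hadj.2.1, hadj.2.2.1⟩
    · rw [mN]; intro h; exact h.2.1 hadj.2.2.2
  · intro u hu v hv1 hv2 huv
    by_cases hvN : v ∈ N
    · exact Or.inl hvN
    right
    apply hER
    rw [hE, Finset.mem_filter]
    refine ⟨?_, (mgrid v).2 ⟨hv1, hv2⟩, hvN⟩
    obtain ⟨⟨hu1, hu2⟩, hu3, hu4⟩ := (mN u).1 hu
    have hlt : 2 * m1 * (u.2 / 3) < n' := by unfold jgIdx at hu4; omega
    have hqq := hq _ hlt
    rw [mN] at hvN
    by_cases hout : v = jgOut m2 u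
    · rw [hout]
      exact Finset.mem_union_left _ (Finset.mem_image_of_mem _ hu)
    apply Finset.mem_union_right
    obtain ⟨x, y⟩ := u
    obtain ⟨x', y'⟩ := v
    have hyy : y' / 3 = y / 3 ∧ y' % 3 ≠ 0 := by
      unfold jgOut at hout
      unfold jgAdj jgCyc at huv
      simp only at *
      split_ifs at hout <;> simp only [Prod.mk.injEq, not_and] at hout <;> omega
    have hjle : y / 3 ≤ j0 := by
      rw [hj0, Nat.le_div_iff_mul_le (by omega)]
      simp only at hlt
      rw [mul_comm]; omega
    simp only [jgIdx] at hvN hu4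
    rw [hyy.1] at hvN
    have hjeq : y / 3 = j0 := by
      by_contra hne
      have h3 : 2 * m1 * (y / 3 + 1) ≤ 2 * m1 * j0 := Nat.mul_le_mul_left _ (by omega)
      rw [mul_add] at h3
      apply hvN
      simp only at *
      omega
    rw [hjeq] at hvN hu4
    simp only [hX, Finset.mem_insert, Finset.mem_singleton, Prod.mk.injEq]
    unfold jgAdj jgCyc at huv
    simp only at *
    generalize 2 * m1 * j0 = Z at *
    split_ifs <;> omega


open Classical in
theorem jg_stage1 {S A T : Type*} [Fintype S] (t : A → T) (π : S → S)
    (hπ : ∀ s, π (π s) = s) (F : S → Prop) (Q : (S ≃ A) → Prop)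
    (hQ : ∀ (e : S ≃ A) (a b : S), Q e → ¬ F a → ¬ F b → Q ((Equiv.swap a b).trans e))
    (hF : ∀ s, π s ≠ s → ¬ F s ∨ ¬ F (π s))
    (hc : ∀ e, Q e → ∀ c, 2 * #{s : S | π s ≠ s ∧ t (e s) = c} ≤ #{s : S | π s ≠ s}) :
    ∀ (k : ℕ) (e : S ≃ A), Q e → #{s : S | π s ≠ s ∧ t (e s) = t (e (π s))} ≤ k →
      ∃ e : S ≃ A, Q e ∧ ∀ s, π s ≠ s → t (e s) ≠ t (e (π s)) := by
  have hinj : Function.Injective π := fun a b h => by rw [← hπ a, h, hπ]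
  intro k
  induction k with
  | zero =>
    intro e he hk
    refine ⟨e, he, fun s hs h => ?_⟩
    have : #{s : S | π s ≠ s ∧ t (e s) = t (e (π s))} = 0 := by omega
    rw [Finset.card_eq_zero, Finset.filter_eq_empty_iff] at this
    exact this (Finset.mem_univ s) ⟨hs, h⟩
  | succ k ih =>
    intro e he hk
    by_cases hall : ∀ s, π s ≠ s → t (e s) ≠ t (e (π s))
    · exact ⟨e, he, hall⟩
    push Not at hall
    obtain ⟨s0, hs0, hmono0⟩ := hall
    obtain ⟨a, ha, hmono, hFa⟩ : ∃ a, π a ≠ a ∧ t (e a) = t (e (π a)) ∧ ¬ F a := by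
      rcases hF s0 hs0 with h | h
      · exact ⟨s0, hs0, hmono0, h⟩
      · exact ⟨π s0, by rw [hπ]; exact hs0.symm, by rw [hπ]; exact hmono0.symm, h⟩
    set c := t (e a) with hcdef
    -- find a pair with no c
    obtain ⟨z0, hz0, hz1, hz2⟩ : ∃ z, π z ≠ z ∧ t (e z) ≠ c ∧ t (e (π z)) ≠ c := by
      by_contra hno
      push Not at hno
      have h1 := hc e he c
      have hpi : #{s : S | π s ≠ s ∧ t (e s) ≠ c} < #{s : S | π s ≠ s ∧ t (e s) = c} := by
        rw [← Finset.card_image_of_injective {s : S | π s ≠ s ∧ t (e s) ≠ c} hinj]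
        apply Finset.card_lt_card
        rw [Finset.ssubset_iff_of_subset]
        · refine ⟨a, by simp [ha, hcdef], ?_⟩
          simp only [Finset.mem_image, Finset.mem_filter, Finset.mem_univ, true_and, not_exists, not_and]
          rintro s ⟨_, h3⟩ h4
          apply h3
          rw [hmono, ← h4, hπ]
        · intro s hs
          simp only [Finset.mem_image, Finset.mem_filter, Finset.mem_univ, true_and] at hs ⊢
          obtain ⟨s', ⟨h3, h4⟩, rfl⟩ := hs
          refine ⟨by rw [hπ]; exact h3.symm, hno s' h3 h4⟩
      have hsum : #{s : S | π s ≠ s} = #{s : S | π s ≠ s ∧ t (e s) = c} + #{s : S | π s ≠ s ∧ t (e s) ≠ c} := by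
        rw [← Finset.card_filter_add_card_filter_not (s := {s : S | π s ≠ s}) (fun s => t (e s) = c)]
        rw [Finset.filter_filter, Finset.filter_filter]
      omega
    obtain ⟨b, hb, hb1, hb2, hFb⟩ : ∃ z, π z ≠ z ∧ t (e z) ≠ c ∧ t (e (π z)) ≠ c ∧ ¬ F z := by
      rcases hF z0 hz0 with h | h
      · exact ⟨z0, hz0, hz1, hz2, h⟩
      · exact ⟨π z0, by rw [hπ]; exact hz0.symm, hz2, by rw [hπ]; exact hz1, h⟩
    have hab : a ≠ b := by rintro rfl; exact hb1 rfl
    have hpab : π a ≠ b := by rintro rfl; exact hb1 hmono.symm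
    have hapb : a ≠ π b := by rintro rfl; exact hb2 rfl
    have hpp : π a ≠ π b := fun h => hab (hinj h)
    apply ih _ (hQ e a b he hFa hFb)
    have : #{s : S | π s ≠ s ∧ t (((Equiv.swap a b).trans e) s) = t (((Equiv.swap a b).trans e) (π s))}
        < #{s : S | π s ≠ s ∧ t (e s) = t (e (π s))} := by
      apply Finset.card_lt_card
      rw [Finset.ssubset_iff_of_subset]
      · refine ⟨a, by simp [ha, ← hmono, hcdef], ?_⟩
        simp only [Finset.mem_filter, Finset.mem_univ, true_and, not_and]
        intro _
        simp only [Equiv.trans_apply, Equiv.swap_apply_left]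
        rw [Equiv.swap_apply_of_ne_of_ne ha hpab, ← hmono]
        exact hb1
      · intro s hs
        rw [Finset.mem_filter] at hs ⊢
        obtain ⟨_, h1, h2⟩ := hs
        simp only [Equiv.trans_apply] at h2
        refine ⟨Finset.mem_univ _, h1, ?_⟩
        by_cases hsa : s = a
        · subst hsa
          rw [Equiv.swap_apply_left, Equiv.swap_apply_of_ne_of_ne ha hpab, ← hmono] at h2
          exact absurd h2 hb1
        by_cases hsb : s = b
        · subst hsb
          rw [Equiv.swap_apply_right, Equiv.swap_apply_of_ne_of_ne hapb.symm hb] at h2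
          exact absurd h2.symm hb2
        by_cases hspa : s = π a
        · subst hspa
          rw [hπ, Equiv.swap_apply_left, Equiv.swap_apply_of_ne_of_ne ha hpab, ← hmono] at h2
          exact absurd h2.symm hb1
        by_cases hspb : s = π b
        · subst hspb
          rw [hπ, Equiv.swap_apply_right, Equiv.swap_apply_of_ne_of_ne hapb.symm hb] at h2
          exact absurd h2 hb2
        rw [Equiv.swap_apply_of_ne_of_ne hsa hsb, Equiv.swap_apply_of_ne_of_ne] at h2
        · exact h2
        · intro h; exact hspa (by rw [← h, hπ])
        · intro h; exact hspb (by rw [← h, hπ])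
    omega

open Classical in
theorem jg_stage2 {S A T : Type*} [Fintype S] (t : A → T) (π : S → S)
    (hπ : ∀ s, π (π s) = s) (F : S → Prop) (Q : (S ≃ A) → Prop) (y : S → S) (c0 : T)
    (hQ : ∀ (e : S ≃ A) (a b : S), Q e → ¬ F a → ¬ F b → Q ((Equiv.swap a b).trans e))
    (hyF : ∀ x, π x = x → (¬ F (y x) ∧ ¬ F (π (y x))) ∨ ∀ e, Q e → t (e (π (y x))) = c0)
    (hy : ∀ x, π x = x → π (y x) ≠ y x)
    (hyy : ∀ x x', π x = x → π x' = x' → (y x = y x' ∨ y x = π (y x')) → x = x') :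
    ∀ (k : ℕ) (e : S ≃ A), Q e → (∀ s, π s ≠ s → t (e s) ≠ t (e (π s))) →
      #{x : S | π x = x ∧ t (e (y x)) = c0} ≤ k →
      ∃ e : S ≃ A, Q e ∧ (∀ s, π s ≠ s → t (e s) ≠ t (e (π s))) ∧
        ∀ x, π x = x → t (e (y x)) ≠ c0 := by
  have hinj : Function.Injective π := fun a b h => by rw [← hπ a, h, hπ]
  intro k
  induction k with
  | zero =>
    intro e he hm hk
    refine ⟨e, he, hm, fun s hs h => ?_⟩
    have : #{x : S | π x = x ∧ t (e (y x)) = c0} = 0 := by omega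
    rw [Finset.card_eq_zero, Finset.filter_eq_empty_iff] at this
    exact this (Finset.mem_univ s) ⟨hs, h⟩
  | succ k ih =>
    intro e he hm hk
    by_cases hall : ∀ x, π x = x → t (e (y x)) ≠ c0
    · exact ⟨e, he, hm, hall⟩
    push Not at hall
    obtain ⟨x, hx, hxc⟩ := hall
    have hyx := hy x hx
    rcases hyF x hx with hyF1 | hyF1
    swap
    · exact absurd (hxc.trans (hyF1 e he).symm) (hm _ hyx)
    apply ih _ (hQ e (y x) (π (y x)) he hyF1.1 hyF1.2)
    · intro s hs
      simp only [Equiv.trans_apply]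
      by_cases h1 : s = y x
      · subst h1
        rw [Equiv.swap_apply_left, Equiv.swap_apply_right]
        exact (hm _ hs).symm
      by_cases h2 : s = π (y x)
      · subst h2
        rw [hπ, Equiv.swap_apply_left, Equiv.swap_apply_right]
        exact (hm _ hyx)
      rw [Equiv.swap_apply_of_ne_of_ne h1 h2, Equiv.swap_apply_of_ne_of_ne]
      · exact hm s hs
      · intro h; exact h2 (by rw [← h, hπ])
      · intro h; exact h1 (hinj h)
    · have : #{x' : S | π x' = x' ∧ t (((Equiv.swap (y x) (π (y x))).trans e) (y x')) = c0}
        < #{x : S | π x = x ∧ t (e (y x)) = c0} := by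
        apply Finset.card_lt_card
        rw [Finset.ssubset_iff_of_subset]
        · refine ⟨x, by simp [hx, hxc], ?_⟩
          rw [Finset.mem_filter]
          rintro ⟨_, _, h⟩
          simp only [Equiv.trans_apply, Equiv.swap_apply_left] at h
          exact hm _ hyx (hxc.trans h.symm)
        · intro s hs
          rw [Finset.mem_filter] at hs ⊢
          obtain ⟨_, h1, h2⟩ := hs
          simp only [Equiv.trans_apply] at h2
          refine ⟨Finset.mem_univ _, h1, ?_⟩
          by_cases hsx : s = x
          · rw [hsx]; exact hxc
          rw [Equiv.swap_apply_of_ne_of_ne] at h2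
          · exact h2
          · intro h; exact hsx (hyy s x h1 hx (Or.inl h))
          · intro h; exact hsx (hyy s x h1 hx (Or.inr h))
      omega

open Classical in
/-- Combinatorial core: fill a layout with agents. -/
theorem jg_fill {S A T : Type*} [Fintype S] [Fintype A] (t : A → T) (r0 c0 : T) (π y : S → S)
    (hcard : Fintype.card S = Fintype.card A)
    (hπ : ∀ s, π (π s) = s) (P : Finset S)
    (hP : ∀ s ∈ P, π s ∉ P)
    (hyF : ∀ x, π x = x → y x ∉ P ∧ (π (y x) ∉ P ∨ c0 = r0))
    (hy : ∀ x, π x = x → π (y x) ≠ y x)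
    (hyy : ∀ x x', π x = x → π x' = x' → (y x = y x' ∨ y x = π (y x')) → x = x')
    (B1 B2 : Finset A) (hB : Disjoint B1 B2) (hB1 : #B1 = #P)
    (hB2 : #B2 = #{s : S | π s = s})
    (hr : ∀ a ∈ B1, t a = r0) (hc0 : ∀ a ∈ B2, t a = c0)
    (hc : ∀ c, 2 * #{a : A | a ∉ B2 ∧ t a = c} + #B2 ≤ Fintype.card A ∨
      (c = c0 ∧ 2 * #{a : A | t a = c} ≤ Fintype.card A + #B2)) :
    ∃ e : S ≃ A, (∀ s ∈ P, t (e s) = r0) ∧ (∀ s, π s ≠ s → t (e s) ≠ t (e (π s))) ∧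
        ∀ x, π x = x → t (e (y x)) ≠ t (e x) := by
  set X : Finset S := {s : S | π s = s} with hX
  have hPX : Disjoint P X := by
    rw [Finset.disjoint_left]
    intro s hs hx
    have : π s = s := by simpa [hX] using hx
    exact hP s hs (by rwa [this])
  set F : S → Prop := fun s => s ∈ P ∨ s ∈ X with hF
  set Q : (S ≃ A) → Prop := fun e => (∀ s ∈ P, t (e s) = r0) ∧ (∀ s ∈ X, t (e s) = c0) with hQd
  have hQ : ∀ (e : S ≃ A) (a b : S), Q e → ¬ F a → ¬ F b → Q ((Equiv.swap a b).trans e) := by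
    rintro e a b ⟨h1, h2⟩ ha hb
    constructor
    · intro s hs
      rw [Equiv.trans_apply, Equiv.swap_apply_of_ne_of_ne]
      · exact h1 s hs
      · rintro rfl; exact ha (Or.inl hs)
      · rintro rfl; exact hb (Or.inl hs)
    · intro s hs
      rw [Equiv.trans_apply, Equiv.swap_apply_of_ne_of_ne]
      · exact h2 s hs
      · rintro rfl; exact ha (Or.inr hs)
      · rintro rfl; exact hb (Or.inr hs)
  have hmX : ∀ s, s ∈ X ↔ π s = s := by intro s; simp [hX]
  have hyX : ∀ x, π x = x →
      (¬ F (y x) ∧ ¬ F (π (y x))) ∨ ∀ e, Q e → t (e (π (y x))) = c0 := by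
    intro x hx
    by_cases hyp : π (y x) ∈ P
    · right
      rintro e ⟨he, _⟩
      rcases (hyF x hx).2 with h | h
      · exact absurd hyp h
      · rw [he _ hyp, h]
    left
    constructor
    · rintro (h | h)
      · exact (hyF x hx).1 h
      · exact hy x hx ((hmX _).1 h)
    · rintro (h | h)
      · exact hyp h
      · have := (hmX _).1 h
        rw [hπ] at this
        exact hy x hx this.symm
  -- initial equivalence
  obtain ⟨e0, he0⟩ : ∃ e, Q e := by
    have g1 : Nonempty (P ≃ B1) := ⟨Finset.equivOfCardEq hB1.symm⟩
    have g2 : Nonempty (X ≃ B2) := ⟨Finset.equivOfCardEq hB2.symm⟩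
    obtain ⟨g1⟩ := g1
    obtain ⟨g2⟩ := g2
    have hne : Nonempty S → Nonempty A := by
      rintro ⟨s⟩
      have : 0 < Fintype.card S := Fintype.card_pos_iff.2 ⟨s⟩
      rw [hcard] at this
      exact Fintype.card_pos_iff.1 this
    let f : S → A := fun s => if h : s ∈ P then g1 ⟨s, h⟩ else if h : s ∈ X then g2 ⟨s, h⟩
      else (hne ⟨s⟩).some
    have f1 : ∀ s (h : s ∈ P), f s = g1 ⟨s, h⟩ := by intro s h; simp [f, h]
    have f2 : ∀ s (h : s ∈ X), f s = g2 ⟨s, h⟩ := by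
      intro s h
      have : s ∉ P := fun h' => (Finset.disjoint_left.1 hPX) h' h
      simp [f, h, this]
    obtain ⟨g, hg⟩ := Finset.exists_equiv_extend_of_card_eq (α := S) (β := A) (t := Finset.univ)
      (by rw [hcard, Finset.card_univ]) (s := P ∪ X) (f := f) (Finset.subset_univ _) (by
        intro a ha b hb hab
        simp only [Finset.coe_union, Set.mem_union, Finset.mem_coe] at ha hb
        rcases ha with ha | ha <;> rcases hb with hb | hb
        · rw [f1 a ha, f1 b hb] at hab
          simpa using g1.injective (Subtype.ext hab)
        · rw [f1 a ha, f2 b hb] at hab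
          exact absurd (hab ▸ (g1 ⟨a, ha⟩).2) (fun h => Finset.disjoint_left.1 hB h (g2 ⟨b, hb⟩).2)
        · rw [f2 a ha, f1 b hb] at hab
          exact absurd (hab ▸ (g2 ⟨a, ha⟩).2) (fun h => Finset.disjoint_left.1 hB (g1 ⟨b, hb⟩).2 h)
        · rw [f2 a ha, f2 b hb] at hab
          simpa using g2.injective (Subtype.ext hab))
    refine ⟨g.trans (Equiv.subtypeUnivEquiv (fun x => Finset.mem_univ x)), ?_, ?_⟩
    · intro s hs
      have := hg s (Finset.mem_union_left _ hs)
      simp only [Equiv.trans_apply, Equiv.subtypeUnivEquiv_apply]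
      rw [this, f1 s hs]
      exact hr _ (g1 ⟨s, hs⟩).2
    · intro s hs
      have := hg s (Finset.mem_union_right _ hs)
      simp only [Equiv.trans_apply, Equiv.subtypeUnivEquiv_apply]
      rw [this, f2 s hs]
      exact hc0 _ (g2 ⟨s, hs⟩).2
  have hcount : ∀ e, Q e → ∀ c, 2 * #{s : S | π s ≠ s ∧ t (e s) = c} ≤ #{s : S | π s ≠ s} := by
    rintro e ⟨_, h2⟩ c
    have hS : #{s : S | π s ≠ s} + #B2 = Fintype.card A := by
      rw [hB2, ← hcard, ← Finset.card_univ (α := S)]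
      rw [← Finset.card_filter_add_card_filter_not (s := (Finset.univ : Finset S)) (fun s => π s ≠ s)]
      congr 2
      ext s
      simp [hX]
    have hall : #{s : S | t (e s) = c} = #{a : A | t a = c} := by
      rw [← Finset.card_map e.toEmbedding]
      congr 1
      ext a
      simp only [Finset.mem_map, Finset.mem_filter, Finset.mem_univ, true_and, Equiv.coe_toEmbedding]
      constructor
      · rintro ⟨s, h, rfl⟩; exact h
      · intro h; exact ⟨e.symm a, by simpa using h, by simp⟩
    have hsplit : #{s : S | t (e s) = c} = #{s : S | π s ≠ s ∧ t (e s) = c} + #{s ∈ X | t (e s) = c} := by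
      rw [← Finset.card_filter_add_card_filter_not (s := {s : S | t (e s) = c}) (fun s => π s ≠ s)]
      rw [Finset.filter_filter, Finset.filter_filter, hX, Finset.filter_filter]
      simp only [not_not, and_comm]
    have hsplitA : #{a : A | t a = c} = #{a : A | a ∉ B2 ∧ t a = c} + #{a ∈ B2 | t a = c} := by
      rw [← Finset.card_filter_add_card_filter_not (s := {a : A | t a = c}) (fun a => a ∉ B2)]
      rw [Finset.filter_filter, Finset.filter_filter]
      congr 2
      · ext a; simp [and_comm]
      · ext a; simp [and_comm]
    have hBX : #{s ∈ X | t (e s) = c} = #{a ∈ B2 | t a = c} := by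
      by_cases hcc : c = c0
      · rw [Finset.filter_true_of_mem, Finset.filter_true_of_mem]
        · exact hB2.symm
        · intro a ha; rw [hc0 a ha, hcc]
        · intro a ha; rw [h2 a ha, hcc]
      · rw [Finset.filter_false_of_mem, Finset.filter_false_of_mem]
        · simp
        · intro a ha; rw [hc0 a ha]; exact fun h => hcc h.symm
        · intro a ha; rw [h2 a ha]; exact fun h => hcc h.symm
    rcases hc c with h | ⟨h, h'⟩
    · omega
    · have : #{a ∈ B2 | t a = c} = #B2 := by
        rw [Finset.filter_true_of_mem]
        intro a ha; rw [hc0 a ha, h]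
      omega
  have hFF : ∀ s, π s ≠ s → ¬ F s ∨ ¬ F (π s) := by
    intro s hs
    by_cases h : s ∈ P
    · right
      rintro (h' | h')
      · exact hP s h h'
      · have := (hmX _).1 h'
        rw [hπ] at this
        exact hs this.symm
    · left
      rintro (h' | h')
      · exact h h'
      · exact hs ((hmX _).1 h')
  obtain ⟨e1, he1, hm1⟩ := jg_stage1 t π hπ F Q hQ hFF hcount _ e0 he0 le_rfl
  obtain ⟨e2, he2, hm2, hx2⟩ := jg_stage2 t π hπ F Q y c0 hQ hyX hy hyy _ e1 he1 hm1 le_rfl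
  refine ⟨e2, he2.1, hm2, fun x hx => ?_⟩
  rw [he2.2 x ((hmX x).2 hx)]
  exact hx2 x hx


/-- A layout: occupied region `D`, pairing `π`, helper neighbours `y` of the unpaired cells,
and cells `P` that must get the majority type. -/
structure JgLay (m1 m2 n d : ℕ) (D : Finset (ℕ × ℕ)) (π y : ℕ × ℕ → ℕ × ℕ)
    (P : Finset (ℕ × ℕ)) : Prop where
  grid : ∀ u ∈ D, u.1 < m1 ∧ u.2 < m2
  card : #D = n
  mem : ∀ u ∈ D, π u ∈ D
  inv : ∀ u ∈ D, π (π u) = u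
  adj : ∀ u ∈ D, π u ≠ u → jgAdj m1 m2 u (π u)
  PD : P ⊆ D
  PP : ∀ u ∈ P, π u ∉ P
  ymem : ∀ u ∈ D, π u = u → y u ∈ D
  yadj : ∀ u ∈ D, π u = u → jgAdj m1 m2 u (y u)
  yP : ∀ u ∈ D, π u = u → y u ∉ P
  yP2 : d ≤ 1 → ∀ u ∈ D, π u = u → π (y u) ∉ P
  yne : ∀ u ∈ D, π u = u → π (y u) ≠ y u
  yy : ∀ u ∈ D, ∀ v ∈ D, π u = u → π v = v → (y u = y v ∨ y u = π (y v)) → u = v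
  emp : ∀ w : ℕ × ℕ, w.1 < m1 → w.2 < m2 → w ∉ D → ∀ u ∈ D, ∀ v ∈ D,
    jgAdj m1 m2 w u → jgAdj m1 m2 w v → u ≠ v → u ∈ P ∧ v ∈ P
  fix : #{u ∈ D | π u = u} = d

open Classical in
theorem jg_of_layout {A T : Type*} [Fintype A] (t : A → T) (r0 c0 : T) {m1 m2 d : ℕ}
    {D : Finset (ℕ × ℕ)} {π y : ℕ × ℕ → ℕ × ℕ} {P : Finset (ℕ × ℕ)}
    (L : JgLay m1 m2 (Fintype.card A) d D π y P)
    (B1 B2 : Finset A) (hB : Disjoint B1 B2) (hB1 : #B1 = #P)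
    (hB2 : #B2 = d) (hd : d ≤ 1 ∨ c0 = r0)
    (hr : ∀ a ∈ B1, t a = r0) (hc0 : ∀ a ∈ B2, t a = c0)
    (hc : ∀ c, 2 * #{a : A | a ∉ B2 ∧ t a = c} + #B2 ≤ Fintype.card A ∨
      (c = c0 ∧ 2 * #{a : A | t a = c} ≤ Fintype.card A + #B2)) :
    ∃ σ : A → ℕ × ℕ, JgNG m1 m2 t σ := by
  let π' : D → D := fun s => ⟨π s, L.mem s s.2⟩
  let y' : D → D := fun s => if h : π s = s then ⟨y s, L.ymem s s.2 h⟩ else s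
  have eπ : ∀ s : D, ((π' s : D) : ℕ × ℕ) = π s := fun s => rfl
  have ey : ∀ s : D, π s = s → ((y' s : D) : ℕ × ℕ) = y s := by
    intro s h; simp [y', h]
  have fx : ∀ s : D, π' s = s ↔ π s = s := by
    intro s; rw [Subtype.ext_iff, eπ]
  obtain ⟨e, e1, e2, e3⟩ := jg_fill t r0 c0 π' y' (by rw [Fintype.card_coe]; exact L.card)
    (fun s => Subtype.ext (L.inv s s.2)) ({s : D | (s : ℕ × ℕ) ∈ P} : Finset D)
    (by
      intro s hs
      rw [Finset.mem_filter] at hs ⊢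
      rintro ⟨_, h⟩
      exact L.PP s hs.2 h)
    (by
      intro x hx
      rw [fx] at hx
      rw [Finset.mem_filter, Finset.mem_filter]
      rw [eπ, ey x hx]
      exact ⟨fun h => L.yP x x.2 hx h.2, hd.imp (fun hd h => L.yP2 hd x x.2 hx h.2) id⟩)
    (by
      intro x hx
      rw [fx] at hx
      rw [Ne, fx, ey x hx]
      exact L.yne x x.2 hx)
    (by
      intro x x' hx hx' h
      rw [fx] at hx hx'
      rw [Subtype.ext_iff, Subtype.ext_iff, eπ, ey x hx, ey x' hx'] at h
      exact Subtype.ext (L.yy x x.2 x' x'.2 hx hx' h))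
    B1 B2 hB
    (by
      rw [hB1, ← Finset.card_map (Function.Embedding.subtype (· ∈ D))]
      congr 1
      ext u
      simp only [Finset.mem_map, Finset.mem_filter, Finset.mem_univ, true_and,
        Function.Embedding.subtype_apply]
      constructor
      · intro h; exact ⟨⟨u, L.PD h⟩, h, rfl⟩
      · rintro ⟨s, h, rfl⟩; exact h)
    (by
      rw [hB2, ← L.fix, ← Finset.card_map (Function.Embedding.subtype (· ∈ D))]
      congr 1
      ext u
      simp only [Finset.mem_map, Finset.mem_filter, Finset.mem_univ, true_and,
        Function.Embedding.subtype_apply]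
      constructor
      · rintro ⟨h, h'⟩; exact ⟨⟨u, h⟩, (fx _).2 h', rfl⟩
      · rintro ⟨s, h, rfl⟩; exact ⟨s.2, (fx _).1 h⟩)
    hr hc0 hc
  let σ : A → ℕ × ℕ := fun a => (e.symm a : ℕ × ℕ)
  have hσ : ∀ s : D, σ (e s) = s := by intro s; simp [σ]
  have hσD : ∀ a, σ a ∈ D := fun a => (e.symm a).2
  have hemp : ∀ w : ℕ × ℕ, (∀ i, σ i ≠ w) → w ∉ D := by
    intro w hw h
    exact hw (e ⟨w, h⟩) (hσ _)
  have hPt : ∀ a, σ a ∈ P → t a = r0 := by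
    intro a ha
    have := e1 (e.symm a) (by rw [Finset.mem_filter]; exact ⟨Finset.mem_univ _, ha⟩)
    simpa using this
  refine ⟨σ, ?_, ?_, ?_, ?_⟩
  · intro a b h
    exact e.symm.injective (Subtype.ext h)
  · intro a
    exact L.grid _ (hσD a)
  · intro w h1 h2 hw i j hi hj
    by_cases hij : σ i = σ j
    · have : i = j := e.symm.injective (Subtype.ext hij)
      rw [this]
    · obtain ⟨p1, p2⟩ := L.emp w h1 h2 (hemp w hw) _ (hσD i) _ (hσD j) hi hj hij
      rw [hPt i p1, hPt j p2]
  · intro i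
    left
    obtain ⟨s, rfl⟩ := e.surjective i
    by_cases h : π s = s
    · refine ⟨e (y' s), ?_, e3 s ((fx s).2 h)⟩
      rw [hσ, hσ, ey s h]
      exact L.yadj s s.2 h
    · refine ⟨e (π' s), ?_, (e2 s (by rw [Ne, fx]; exact h)).symm⟩
      rw [hσ, hσ, eπ]
      exact L.adj s s.2 h

/-- Base layout with at most one unpaired cell, together with a pair that may be broken. -/
structure JgBase (m1 m2 n : ℕ) (D : Finset (ℕ × ℕ)) (π y : ℕ × ℕ → ℕ × ℕ)
    (P : Finset (ℕ × ℕ)) (x1 x2 y1 y2 : ℕ × ℕ) : Prop where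
  grid : ∀ u ∈ D, u.1 < m1 ∧ u.2 < m2
  card : #D = n
  mem : ∀ u ∈ D, π u ∈ D
  inv : ∀ u ∈ D, π (π u) = u
  adj : ∀ u ∈ D, π u ≠ u → jgAdj m1 m2 u (π u)
  PD : P ⊆ D
  PP : ∀ u ∈ P, π u ∉ P
  ymem : ∀ u ∈ D, π u = u → y u ∈ D
  yadj : ∀ u ∈ D, π u = u → jgAdj m1 m2 u (y u)
  yP : ∀ u ∈ D, π u = u → y u ∉ P
  yP2 : ∀ u ∈ D, π u = u → π (y u) ∉ P
  yne : ∀ u ∈ D, π u = u → π (y u) ≠ y u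
  uniq : ∀ u ∈ D, ∀ v ∈ D, π u = u → π v = v → u = v
  emp : ∀ w : ℕ × ℕ, w.1 < m1 → w.2 < m2 → w ∉ D → ∀ u ∈ D, ∀ v ∈ D,
    jgAdj m1 m2 w u → jgAdj m1 m2 w v → u ≠ v → u ∈ P ∧ v ∈ P
  x1D : x1 ∈ D
  px1 : π x1 = x2
  x12 : x1 ≠ x2
  x1P : x1 ∉ P
  x2P : x2 ∉ P
  y1D : y1 ∈ D
  y2D : y2 ∈ D
  adj1 : jgAdj m1 m2 x1 y1
  adj2 : jgAdj m1 m2 x2 y2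
  y1P : y1 ∉ P
  y2P : y2 ∉ P
  py1 : π y1 ≠ y1
  py2 : π y2 ≠ y2
  yx : y1 ≠ x1 ∧ y1 ≠ x2 ∧ y2 ≠ x1 ∧ y2 ≠ x2
  y12 : y1 ≠ y2 ∧ y1 ≠ π y2
  y0 : ∀ u ∈ D, π u = u → y u ≠ x1 ∧ y u ≠ x2 ∧ y u ≠ y1 ∧ y u ≠ y2 ∧ y u ≠ π y1 ∧ y u ≠ π y2

theorem jg_fix_parity {D : Finset (ℕ × ℕ)} {π : ℕ × ℕ → ℕ × ℕ}
    (mem : ∀ u ∈ D, π u ∈ D) (inv : ∀ u ∈ D, π (π u) = u)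
    (uniq : ∀ u ∈ D, ∀ v ∈ D, π u = u → π v = v → u = v) :
    #{u ∈ D | π u = u} = #D % 2 := by
  have hle : #{u ∈ D | π u = u} ≤ 1 := by
    rw [Finset.card_le_one]
    intro a ha b hb
    rw [Finset.mem_filter] at ha hb
    exact uniq a ha.1 b hb.1 ha.2 hb.2
  have hev : Even #{u ∈ D | π u ≠ u} := by
    have hs : ∑ u ∈ {u ∈ D | π u ≠ u}, (1 : ZMod 2) = 0 := by
      apply Finset.sum_involution (fun u _ => π u)
      · intro a _; decide
      · intro a ha _
        exact (Finset.mem_filter.1 ha).2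
      · intro a ha
        rw [Finset.mem_filter] at ha ⊢
        refine ⟨mem a ha.1, ?_⟩
        rw [inv a ha.1]
        exact ha.2.symm
      · intro a ha
        exact inv a (Finset.mem_filter.1 ha).1
    rw [Finset.sum_const, nsmul_eq_mul, mul_one] at hs
    rw [ZMod.natCast_eq_zero_iff] at hs
    exact even_iff_two_dvd.2 hs
  have hsum := Finset.card_filter_add_card_filter_not (s := D) (fun u => π u = u)
  simp only [ne_eq] at hev
  obtain ⟨r, hr⟩ := hev
  omega

theorem jg_base_lay {m1 m2 n : ℕ} {D : Finset (ℕ × ℕ)} {π y : ℕ × ℕ → ℕ × ℕ}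
    {P : Finset (ℕ × ℕ)} {x1 x2 y1 y2 : ℕ × ℕ} (L : JgBase m1 m2 n D π y P x1 x2 y1 y2) :
    JgLay m1 m2 n (n % 2) D π y P :=
  ⟨L.grid, L.card, L.mem, L.inv, L.adj, L.PD, L.PP, L.ymem, L.yadj, L.yP,
    fun _ => L.yP2, L.yne, fun u hu v hv h1 h2 _ => L.uniq u hu v hv h1 h2, L.emp,
    by rw [jg_fix_parity L.mem L.inv L.uniq, L.card]⟩

theorem jg_base_lay2 {m1 m2 n : ℕ} {D : Finset (ℕ × ℕ)} {π y : ℕ × ℕ → ℕ × ℕ}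
    {P : Finset (ℕ × ℕ)} {x1 x2 y1 y2 : ℕ × ℕ} (L : JgBase m1 m2 n D π y P x1 x2 y1 y2) :
    JgLay m1 m2 n (n % 2 + 2) D (fun u => if u = x1 ∨ u = x2 then u else π u)
      (fun u => if u = x1 then y1 else if u = x2 then y2 else y u) P := by
  have px2 : π x2 = x1 := by rw [← L.px1, L.inv _ L.x1D]
  have x2D : x2 ∈ D := by rw [← L.px1]; exact L.mem _ L.x1D
  have hx12 := L.x12
  have px1 := L.px1
  have ne1 : ∀ u ∈ D, π u = x1 → u = x2 := by
    intro u hu h; rw [← L.inv u hu, h, px1]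
  have ne2 : ∀ u ∈ D, π u = x2 → u = x1 := by
    intro u hu h; rw [← L.inv u hu, h, px2]
  obtain ⟨yx1, yx2, yx3, yx4⟩ := L.yx
  -- fixed points of the new pairing
  have hf : ∀ u ∈ D, (if u = x1 ∨ u = x2 then u else π u) = u →
      u = x1 ∨ u = x2 ∨ (u ≠ x1 ∧ u ≠ x2 ∧ π u = u) := by
    intro u hu h
    by_cases h1 : u = x1
    · exact Or.inl h1
    by_cases h2 : u = x2
    · exact Or.inr (Or.inl h2)
    simp only [h1, h2, or_self, if_false] at h
    exact Or.inr (Or.inr ⟨h1, h2, h⟩)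
  have hyv : ∀ u ∈ D, (if u = x1 ∨ u = x2 then u else π u) = u →
      ∃ z, (if u = x1 then y1 else if u = x2 then y2 else y u) = z ∧ z ∈ D ∧ jgAdj m1 m2 u z ∧
        z ∉ P ∧ π z ≠ z ∧ z ≠ x1 ∧ z ≠ x2 := by
    intro u hu h
    rcases hf u hu h with rfl | rfl | ⟨h1, h2, h3⟩
    · exact ⟨y1, by simp, L.y1D, L.adj1, L.y1P, L.py1, yx1, yx2⟩
    · exact ⟨y2, by simp [hx12.symm], L.y2D, L.adj2, L.y2P, L.py2, yx3, yx4⟩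
    · obtain ⟨a1, a2, _⟩ := L.y0 u hu h3
      exact ⟨y u, by simp [h1, h2], L.ymem u hu h3, L.yadj u hu h3, L.yP u hu h3,
        L.yne u hu h3, a1, a2⟩
  refine ⟨L.grid, L.card, ?_, ?_, ?_, L.PD, ?_, ?_, ?_, ?_, ?_, ?_, ?_, L.emp, ?_⟩
  · intro u hu
    split_ifs
    · exact hu
    · exact L.mem u hu
  · intro u hu
    by_cases h : u = x1 ∨ u = x2
    · simp only [h, if_true]
    · have h' : ¬ (π u = x1 ∨ π u = x2) := by
        rintro (h' | h')
        · exact h (Or.inr (ne1 u hu h'))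
        · exact h (Or.inl (ne2 u hu h'))
      simp only [h, h', if_false]
      exact L.inv u hu
  · intro u hu
    split_ifs
    · intro h; exact absurd rfl h
    · exact L.adj u hu
  · intro u hu
    have h : ¬ (u = x1 ∨ u = x2) := by
      rintro (rfl | rfl)
      · exact L.x1P hu
      · exact L.x2P hu
    simp only [h, if_false]
    exact L.PP u hu
  · intro u hu h
    obtain ⟨z, hz, h1, _⟩ := hyv u hu h
    simp only [hz]; exact h1
  · intro u hu h
    obtain ⟨z, hz, h1, h2, _⟩ := hyv u hu h
    simp only [hz]; exact h2
  · intro u hu h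
    obtain ⟨z, hz, h1, h2, h3, _⟩ := hyv u hu h
    simp only [hz]; exact h3
  · intro hd; omega
  · intro u hu h
    obtain ⟨z, hz, h1, h2, h3, h5, h6, h7⟩ := hyv u hu h
    simp only [hz, h6, h7, or_self, if_false]; exact h5
  · intro u hu v hv h h' hyy
    have e1 : ∀ a b, b ∈ D → a = π b → b = π a := by
      intro a b hb hab; rw [hab, L.inv b hb]
    obtain ⟨z, hz, g1, g2, g3, g5, g6, g7⟩ := hyv v hv h'
    simp only [hz, g6, g7, or_self, if_false] at hyy
    rcases hf u hu h with rfl | rfl | ⟨h1, h2, h3⟩ <;>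
      rcases hf v hv h' with rfl | rfl | ⟨k1, k2, k3⟩
    · rfl
    · simp only [if_true, hx12.symm, if_false] at hyy hz
      subst hz
      rcases hyy with hyy | hyy
      · exact absurd hyy L.y12.1
      · exact absurd hyy L.y12.2
    · simp only [if_true, k1, k2, if_false] at hyy hz
      subst hz
      obtain ⟨a1, a2, a3, a4, a5, a6⟩ := L.y0 v hv k3
      rcases hyy with hyy | hyy
      · exact absurd hyy.symm a3
      · exact absurd (e1 _ _ (L.ymem v hv k3) hyy) a5
    · simp only [if_true, hx12.symm, if_false] at hyy hz
      subst hz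
      rcases hyy with hyy | hyy
      · exact absurd hyy.symm L.y12.1
      · exact absurd (e1 _ _ L.y1D hyy) L.y12.2
    · rfl
    · simp only [if_true, k1, k2, hx12.symm, if_false] at hyy hz
      subst hz
      obtain ⟨a1, a2, a3, a4, a5, a6⟩ := L.y0 v hv k3
      rcases hyy with hyy | hyy
      · exact absurd hyy.symm a4
      · exact absurd (e1 _ _ (L.ymem v hv k3) hyy) a6
    · simp only [if_true, h1, h2, if_false] at hyy hz
      subst hz
      obtain ⟨a1, a2, a3, a4, a5, a6⟩ := L.y0 u hu h3
      rcases hyy with hyy | hyy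
      · exact absurd hyy a3
      · exact absurd hyy a5
    · simp only [if_true, h1, h2, hx12.symm, if_false] at hyy hz
      subst hz
      obtain ⟨a1, a2, a3, a4, a5, a6⟩ := L.y0 u hu h3
      rcases hyy with hyy | hyy
      · exact absurd hyy a4
      · exact absurd hyy a6
    · exact L.uniq u hu v hv h3 k3
  · have hs : ({u ∈ D | (if u = x1 ∨ u = x2 then u else π u) = u} : Finset (ℕ × ℕ)) =
        insert x1 (insert x2 {u ∈ D | π u = u}) := by
      ext u
      simp only [Finset.mem_filter, Finset.mem_insert]
      constructor
      · rintro ⟨h1, h2⟩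
        rcases hf u h1 h2 with h | h | ⟨_, _, h⟩
        · exact Or.inl h
        · exact Or.inr (Or.inl h)
        · exact Or.inr (Or.inr ⟨h1, h⟩)
      · rintro (rfl | rfl | ⟨h1, h2⟩)
        · exact ⟨L.x1D, by simp⟩
        · exact ⟨x2D, by simp⟩
        · exact ⟨h1, by split_ifs <;> [rfl; exact h2]⟩
    rw [hs, Finset.card_insert_of_notMem, Finset.card_insert_of_notMem,
      jg_fix_parity L.mem L.inv L.uniq, L.card]
    · rw [Finset.mem_filter, px2]; exact fun h => hx12 h.2
    · rw [Finset.mem_insert, Finset.mem_filter, px1]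
      rintro (h | h)
      · exact hx12 h
      · exact hx12 h.2.symm

open Classical in
theorem jg_case1 {A T : Type*} [Fintype A] (t : A → T) (r0 : T) {m1 m2 : ℕ}
    {D : Finset (ℕ × ℕ)} {π y : ℕ × ℕ → ℕ × ℕ}
    {P : Finset (ℕ × ℕ)} {x1 x2 y1 y2 : ℕ × ℕ}
    (L : JgBase m1 m2 (Fintype.card A) D π y P x1 x2 y1 y2)
    (hP : #P ≤ 4 ∨ (#P ≤ 8 ∧ 20 ≤ Fintype.card A))
    (hmax : ∀ c, #{a : A | t a = c} ≤ #{a : A | t a = r0})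
    (h8 : 8 ≤ #{a : A | t a = r0})
    (hsmall : #{a : A | t a = r0} ≤ #{a : A | t a ≠ r0} + 3) :
    ∃ σ : A → ℕ × ℕ, JgNG m1 m2 t σ := by
  have hsum : #{a : A | t a = r0} + #{a : A | t a ≠ r0} = Fintype.card A := by
    rw [← Finset.card_univ, ← Finset.card_filter_add_card_filter_not
      (s := (Finset.univ : Finset A)) (fun a => t a = r0)]
  set n1 := #{a : A | t a = r0} with hn1
  set n' := #{a : A | t a ≠ r0} with hn'
  have hle : ∀ c (B : Finset A), #{a : A | a ∉ B ∧ t a = c} ≤ #{a : A | t a = c} := by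
    intro c B
    apply Finset.card_le_card
    intro a ha
    rw [Finset.mem_filter] at ha ⊢
    exact ⟨ha.1, ha.2.2⟩
  by_cases hcase : n' ≤ n1
  · -- extra agents are of the majority type
    have main : ∀ d π' y', JgLay m1 m2 (Fintype.card A) d D π' y' P → d = n1 - n' →
        ∃ σ : A → ℕ × ℕ, JgNG m1 m2 t σ := by
      intro d π' y' L' hd
      obtain ⟨B2, hB2s, hB2c⟩ := Finset.exists_subset_card_eq
        (show d ≤ #{a : A | t a = r0} by omega)
      obtain ⟨B1, hB1s, hB1c⟩ := Finset.exists_subset_card_eq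
        (show #P ≤ #(({a : A | t a = r0} : Finset A) \ B2) by
          rw [Finset.card_sdiff_of_subset hB2s]; omega)
      have hB2t : ∀ a ∈ B2, t a = r0 := fun a ha => (Finset.mem_filter.1 (hB2s ha)).2
      refine jg_of_layout t r0 r0 L' B1 B2 ?_ hB1c hB2c (Or.inr rfl) ?_ hB2t ?_
      · rw [Finset.disjoint_left]
        intro a ha
        exact (Finset.mem_sdiff.1 (hB1s ha)).2
      · intro a ha
        exact (Finset.mem_filter.1 (Finset.mem_sdiff.1 (hB1s ha)).1).2
      · intro c
        by_cases hcr : c = r0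
        · right
          refine ⟨hcr, ?_⟩
          rw [hcr, hB2c]; omega
        · left
          have a1 := hle c B2
          have a2 : #{a : A | t a = c} ≤ n' := by
            apply Finset.card_le_card
            intro a ha
            rw [Finset.mem_filter] at ha ⊢
            exact ⟨ha.1, by rw [ha.2]; exact hcr⟩
          omega
    by_cases hd : n1 - n' ≤ 1
    · exact main _ _ _ (jg_base_lay L) (by omega)
    · exact main _ _ _ (jg_base_lay2 L) (by omega)
  · -- the extra agent, if any, is of another type
    obtain ⟨a0, ha0⟩ : ({a : A | t a ≠ r0} : Finset A).Nonempty := by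
      rw [← Finset.card_pos]; omega
    rw [Finset.mem_filter] at ha0
    obtain ⟨B2, hB2s, hB2c⟩ := Finset.exists_subset_card_eq
        (show Fintype.card A % 2 ≤ #{a : A | t a = t a0} by
          have : 0 < #{a : A | t a = t a0} :=
            Finset.card_pos.2 ⟨a0, by rw [Finset.mem_filter]; exact ⟨Finset.mem_univ _, rfl⟩⟩
          omega)
    obtain ⟨B1, hB1s, hB1c⟩ := Finset.exists_subset_card_eq
        (show #P ≤ #{a : A | t a = r0} by omega)
    have hB2t : ∀ a ∈ B2, t a = t a0 := fun a ha => (Finset.mem_filter.1 (hB2s ha)).2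
    have hB1t : ∀ a ∈ B1, t a = r0 := fun a ha => (Finset.mem_filter.1 (hB1s ha)).2
    refine jg_of_layout t r0 (t a0) (jg_base_lay L) B1 B2 ?_ hB1c hB2c (Or.inl (by omega)) hB1t hB2t ?_
    · rw [Finset.disjoint_left]
      intro a h1 h2
      exact ha0.2 (by rw [← hB2t a h2, hB1t a h1])
    · intro c
      left
      have a1 := hle c B2
      have a2 := hmax c
      omega


/-- First coordinate of the pairing in the first layout. -/
def jgAf (k0 k1 x y : ℕ) : ℕ :=
  if k0 ≤ x ∧ x < k1 ∧ y = 0 then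
    if (x - k0) % 2 = 1 then x - 1 else if x + 1 < k1 then x + 1 else x
  else x

/-- Second coordinate of the pairing in the first layout. -/
def jgAg (k0 k1 x y : ℕ) : ℕ :=
  if k0 ≤ x ∧ x < k1 then
    if y = 0 then 0 else if y % 2 = 1 then y + 1 else y - 1
  else if y % 2 = 0 then y + 1 else y - 1

theorem jgA_spec (k0 k1 x y : ℕ) :
    (k0 ≤ x ∧ x < k1 ∧ y = 0 ∧ (x - k0) % 2 = 1 ∧ jgAf k0 k1 x y = x - 1 ∧ jgAg k0 k1 x y = 0) ∨
    (k0 ≤ x ∧ x + 1 < k1 ∧ y = 0 ∧ (x - k0) % 2 = 0 ∧ jgAf k0 k1 x y = x + 1 ∧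
      jgAg k0 k1 x y = 0) ∨
    (k0 ≤ x ∧ x + 1 = k1 ∧ y = 0 ∧ (x - k0) % 2 = 0 ∧ jgAf k0 k1 x y = x ∧ jgAg k0 k1 x y = 0) ∨
    (k0 ≤ x ∧ x < k1 ∧ y % 2 = 1 ∧ jgAf k0 k1 x y = x ∧ jgAg k0 k1 x y = y + 1) ∨
    (k0 ≤ x ∧ x < k1 ∧ y % 2 = 0 ∧ 0 < y ∧ jgAf k0 k1 x y = x ∧ jgAg k0 k1 x y + 1 = y) ∨
    ((x < k0 ∨ k1 ≤ x) ∧ y % 2 = 0 ∧ jgAf k0 k1 x y = x ∧ jgAg k0 k1 x y = y + 1) ∨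
    ((x < k0 ∨ k1 ≤ x) ∧ y % 2 = 1 ∧ jgAf k0 k1 x y = x ∧ jgAg k0 k1 x y + 1 = y) := by
  unfold jgAf jgAg
  split_ifs <;> first
    | exact Or.inl (by omega)
    | exact Or.inr (Or.inl (by omega))
    | exact Or.inr (Or.inr (Or.inl (by omega)))
    | exact Or.inr (Or.inr (Or.inr (Or.inl (by omega))))
    | exact Or.inr (Or.inr (Or.inr (Or.inr (Or.inl (by omega)))))
    | exact Or.inr (Or.inr (Or.inr (Or.inr (Or.inr (Or.inl (by omega))))))
    | exact Or.inr (Or.inr (Or.inr (Or.inr (Or.inr (Or.inr (by omega))))))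
    | omega

set_option maxHeartbeats 4000000 in
theorem jg_layoutA {m1 m2 c h r k0 k1 : ℕ} (hc : 3 ≤ c) (hcm : c = m1 ∨ c + 2 ≤ m1)
    (hr : r < c) (hh : 4 ≤ h) (hm : h + 2 ≤ m2) (hm' : 0 < r → h + 3 ≤ m2)
    (hk : (h % 2 = 0 ∧ k0 = 0 ∧ k1 = r) ∨ (h % 2 = 1 ∧ k0 = r ∧ k1 = c)) :
    ∃ (D : Finset (ℕ × ℕ)) (π y : ℕ × ℕ → ℕ × ℕ) (P : Finset (ℕ × ℕ)) (x1 x2 y1 y2 : ℕ × ℕ),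
      #P ≤ 4 ∧ JgBase m1 m2 (c * h + r) D π y P x1 x2 y1 y2 := by
  set D : Finset (ℕ × ℕ) := Finset.range c ×ˢ Finset.range h ∪ Finset.range r ×ˢ {h} with hD
  have mD : ∀ x y, (x, y) ∈ D ↔ (x < c ∧ y < h) ∨ (x < r ∧ y = h) := by
    intro x y
    simp only [hD, Finset.mem_union, Finset.mem_product, Finset.mem_range, Finset.mem_singleton]
  have cD : #D = c * h + r := by
    rw [hD, Finset.card_union_of_disjoint]
    · simp
    · rw [Finset.disjoint_left]
      rintro ⟨x, y⟩ h1 h2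
      simp only [Finset.mem_product, Finset.mem_range, Finset.mem_singleton] at h1 h2
      omega
  set P : Finset (ℕ × ℕ) :=
    {u ∈ ({(0, h), (r - 1, h), (r, h - 1), (c - 1, h - 1)} : Finset (ℕ × ℕ)) | u ∈ D} with hP
  have mP : ∀ x y, (x, y) ∈ P ↔ ((x = 0 ∧ y = h) ∨ (x = r - 1 ∧ y = h) ∨ (x = r ∧ y = h - 1) ∨
      (x = c - 1 ∧ y = h - 1)) ∧ ((x < c ∧ y < h) ∨ (x < r ∧ y = h)) := by
    intro x y
    rw [hP, Finset.mem_filter, mD]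
    simp only [Finset.mem_insert, Finset.mem_singleton, Prod.mk.injEq]
  have cP : #P ≤ 4 := (Finset.card_filter_le _ _).trans Finset.card_le_four
  set π : ℕ × ℕ → ℕ × ℕ := fun u => (jgAf k0 k1 u.1 u.2, jgAg k0 k1 u.1 u.2) with hπ
  have eπ : ∀ x y, π (x, y) = (jgAf k0 k1 x y, jgAg k0 k1 x y) := fun x y => rfl
  set yf : ℕ × ℕ → ℕ × ℕ := fun u => (u.1, u.2 + 1) with hyf
  have spec := jgA_spec k0 k1
  have grid : ∀ u ∈ D, u.1 < m1 ∧ u.2 < m2 := by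
    rintro ⟨x, y⟩ hu
    rw [mD] at hu
    simp only
    omega
  have mem : ∀ u ∈ D, π u ∈ D := by
    rintro ⟨x, y⟩ hu
    rw [eπ, mD]
    rw [mD] at hu
    rcases spec x y with h | h | h | h | h | h | h <;> omega
  have inv : ∀ u ∈ D, π (π u) = u := by
    rintro ⟨x, y⟩ hu
    rw [eπ, Prod.mk.injEq]
    simp only
    have s := spec x y
    have s' := spec (jgAf k0 k1 x y) (jgAg k0 k1 x y)
    rcases s with h | h | h | h | h | h | h <;> rcases s' with h' | h' | h' | h' | h' | h' | h' <;> omega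
  have adj : ∀ u ∈ D, π u ≠ u → jgAdj m1 m2 u (π u) := by
    rintro ⟨x, y⟩ hu
    rw [eπ, Ne, Prod.mk.injEq]
    unfold jgAdj jgCyc
    simp only
    rcases spec x y with h | h | h | h | h | h | h <;> omega
  have PD : P ⊆ D := by
    intro u hu
    exact (Finset.mem_filter.1 hu).2
  have PP : ∀ u ∈ P, π u ∉ P := by
    rintro ⟨x, y⟩ hu
    rw [eπ, mP]
    rw [mP] at hu
    rcases spec x y with h | h | h | h | h | h | h <;> omega
  have fixd : ∀ x y, (x, y) ∈ D → π (x, y) = (x, y) → y = 0 ∧ k0 ≤ x ∧ x + 1 = k1 ∧ (x - k0) % 2 = 0 := by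
    intro x y hu h
    rw [eπ, Prod.mk.injEq] at h
    rcases spec x y with h | h | h | h | h | h | h <;> omega
  have ymem : ∀ u ∈ D, π u = u → yf u ∈ D := by
    rintro ⟨x, y⟩ hu h
    have := fixd x y hu h
    rw [mD] at *
    omega
  have yadj : ∀ u ∈ D, π u = u → jgAdj m1 m2 u (yf u) := by
    rintro ⟨x, y⟩ hu h
    exact Or.inl ⟨rfl, Or.inl rfl⟩
  have yP : ∀ u ∈ D, π u = u → yf u ∉ P := by
    rintro ⟨x, y⟩ hu h
    have := fixd x y hu h
    rw [mP]
    omega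
  have yP2 : ∀ u ∈ D, π u = u → π (yf u) ∉ P := by
    rintro ⟨x, y⟩ hu h
    have := fixd x y hu h
    have s := spec x (y + 1)
    simp only [hyf]
    rw [eπ, mP]
    omega
  have yne : ∀ u ∈ D, π u = u → π (yf u) ≠ yf u := by
    rintro ⟨x, y⟩ hu h
    have := fixd x y hu h
    have s := spec x (y + 1)
    simp only [hyf]
    rw [eπ, Ne, Prod.mk.injEq]
    omega
  have uniq : ∀ u ∈ D, ∀ v ∈ D, π u = u → π v = v → u = v := by
    rintro ⟨x, y⟩ hu ⟨x', y'⟩ hv h h'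
    have := fixd x y hu h
    have := fixd x' y' hv h'
    rw [Prod.mk.injEq]
    omega
  have cls : ∀ a b x y, a < m1 → b < m2 → (a, b) ∉ D → (x, y) ∈ D → jgAdj m1 m2 (a, b) (x, y) →
      (x = a ∧ y + 1 = b ∧ ((b = h ∧ r ≤ a ∧ a < c) ∨ (b = h + 1 ∧ a < r))) ∨
      (x = a ∧ y = 0 ∧ b + 1 = m2) ∨
      (y = b ∧ x + 1 = a ∧ ((a = r ∧ b = h) ∨ (a = c ∧ b < h))) ∨
      (y = b ∧ x = 0 ∧ a + 1 = m1 ∧ ((c < m1 ∧ b ≤ h) ∨ (c = m1 ∧ b = h ∧ 0 < r))) := by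
    intro a b x y h1 h2 hw hu hA
    rw [mD] at hw hu
    unfold jgAdj jgCyc at hA
    simp only at hA
    rcases hA with ⟨e1, e2 | e2 | e2 | e2⟩ | ⟨e1, e2 | e2 | e2 | e2⟩
    · exfalso; omega
    · left; omega
    · exfalso; omega
    · right; left; omega
    · exfalso; omega
    · right; right; left; omega
    · exfalso; omega
    · right; right; right; omega
  have emp : ∀ w : ℕ × ℕ, w.1 < m1 → w.2 < m2 → w ∉ D → ∀ u ∈ D, ∀ v ∈ D,
      jgAdj m1 m2 w u → jgAdj m1 m2 w v → u ≠ v → u ∈ P ∧ v ∈ P := by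
    rintro ⟨a, b⟩ h1 h2 hw ⟨x, y⟩ hu ⟨x', y'⟩ hv hA hA' hne
    have hA := cls a b x y h1 h2 hw hu hA
    have hA' := cls a b x' y' h1 h2 hw hv hA'
    rw [mD] at hw hu hv
    rw [mP, mP]
    rw [Ne, Prod.mk.injEq] at hne
    clear mD mP spec eπ
    rcases hA with e | e | e | e <;> rcases hA' with f | f | f | f <;> omega
  have brk : ∀ X1 X2 Y1 Y2 Z1 Z2 W1 W2 : ℕ, (X1, X2) ∈ D → π (X1, X2) = (Y1, Y2) →
      (X1 = Y1 → X2 = Y2 → False) → (X1, X2) ∉ P → (Y1, Y2) ∉ P → (Z1, Z2) ∈ D → (W1, W2) ∈ D →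
      jgAdj m1 m2 (X1, X2) (Z1, Z2) → jgAdj m1 m2 (Y1, Y2) (W1, W2) → (Z1, Z2) ∉ P →
      (W1, W2) ∉ P → π (Z1, Z2) ≠ (Z1, Z2) → π (W1, W2) ≠ (W1, W2) →
      ((Z1, Z2) ≠ (X1, X2) ∧ (Z1, Z2) ≠ (Y1, Y2) ∧ (W1, W2) ≠ (X1, X2) ∧ (W1, W2) ≠ (Y1, Y2)) →
      ((Z1, Z2) ≠ (W1, W2) ∧ (Z1, Z2) ≠ π (W1, W2)) →
      (∀ x, x + 1 = k1 → k0 ≤ x → (x - k0) % 2 = 0 → (x, 1) ≠ (X1, X2) ∧ (x, 1) ≠ (Y1, Y2) ∧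
        (x, 1) ≠ (Z1, Z2) ∧ (x, 1) ≠ (W1, W2) ∧ (x, 1) ≠ π (Z1, Z2) ∧ (x, 1) ≠ π (W1, W2)) →
      JgBase m1 m2 (c * h + r) D π yf P (X1, X2) (Y1, Y2) (Z1, Z2) (W1, W2) := by
    intro X1 X2 Y1 Y2 Z1 Z2 W1 W2 a1 a2 a3 a4 a5 a6 a7 a8 a9 a10 a11 a12 a13 a14 a15 a16
    refine ⟨grid, cD, mem, inv, adj, PD, PP, ymem, yadj, yP, yP2, yne, uniq, emp, a1, a2, ?_,
      a4, a5, a6, a7, a8, a9, a10, a11, a12, a13, a14, a15, ?_⟩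
    · rw [Ne, Prod.mk.injEq]; exact fun h => a3 h.1 h.2
    · rintro ⟨x, y⟩ hu h
      obtain ⟨rfl, g1, g2, g3⟩ := fixd x y hu h
      exact a16 x g2 g1 g3
  by_cases hev : (h % 2 = 0 ∧ r + 2 ≤ c) ∨ (h % 2 = 1 ∧ 2 ≤ r)
  · obtain ⟨k, hkk⟩ : ∃ k, (h % 2 = 0 ∧ k = r) ∨ (h % 2 = 1 ∧ k = 0) := by
      rcases Nat.mod_two_eq_zero_or_one h with h0 | h0
      · exact ⟨r, Or.inl ⟨h0, rfl⟩⟩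
      · exact ⟨0, Or.inr ⟨h0, rfl⟩⟩
    have s1 : jgAf k0 k1 k 0 = k ∧ jgAg k0 k1 k 0 = 1 := by have := spec k 0; omega
    have s2 : jgAf k0 k1 (k + 1) 0 = k + 1 ∧ jgAg k0 k1 (k + 1) 0 = 1 := by
      have := spec (k + 1) 0; omega
    have s3 : jgAf k0 k1 k 2 = k ∧ jgAg k0 k1 k 2 = 3 := by have := spec k 2; omega
    refine ⟨D, π, yf, P, (k, 0), (k, 1), (k + 1, 0), (k, 2), cP, brk _ _ _ _ _ _ _ _ ?_ ?_ ?_ ?_ ?_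
      ?_ ?_ (Or.inr ⟨rfl, Or.inl rfl⟩) (Or.inl ⟨rfl, Or.inl rfl⟩) ?_ ?_ ?_ ?_ ?_ ?_ ?_⟩ <;>
    simp only [mD, mP, eπ, Prod.mk.injEq, ne_eq, jgAdj, jgCyc] <;> omega
  · have s1 : jgAf k0 k1 k0 1 = k0 ∧ jgAg k0 k1 k0 1 = 2 := by have := spec k0 1; omega
    have s2 : jgAf k0 k1 k0 0 = k0 + 1 ∧ jgAg k0 k1 k0 0 = 0 := by
      have := spec k0 0; omega
    have s3 : jgAf k0 k1 k0 3 = k0 ∧ jgAg k0 k1 k0 3 = 4 := by have := spec k0 3; omega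
    refine ⟨D, π, yf, P, (k0, 1), (k0, 2), (k0, 0), (k0, 3), cP, brk _ _ _ _ _ _ _ _ ?_ ?_ ?_ ?_ ?_
      ?_ ?_ (Or.inl ⟨rfl, Or.inr (Or.inl rfl)⟩) (Or.inl ⟨rfl, Or.inl rfl⟩) ?_ ?_ ?_ ?_ ?_ ?_ ?_⟩ <;>
    simp only [mD, mP, eπ, Prod.mk.injEq, ne_eq, jgAdj, jgCyc] <;> omega


theorem jg_existsA {m1 m2 n : ℕ} (h1 : 9 ≤ m1) (h2 : 9 ≤ m2) (hn : 13 ≤ n)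
    (hn2 : n ≤ m1 * (m2 - 2)) :
    ∃ (D : Finset (ℕ × ℕ)) (π y : ℕ × ℕ → ℕ × ℕ) (P : Finset (ℕ × ℕ)) (x1 x2 y1 y2 : ℕ × ℕ),
      #P ≤ 4 ∧ JgBase m1 m2 n D π y P x1 x2 y1 y2 := by
  obtain ⟨c, h, r, e, hc, hcm, hr, hh, hm, hm'⟩ : ∃ c h r, c * h + r = n ∧ 3 ≤ c ∧
      (c = m1 ∨ c + 2 ≤ m1) ∧ r < c ∧ 4 ≤ h ∧ h + 2 ≤ m2 ∧ (0 < r → h + 3 ≤ m2) := by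
    by_cases hb : 4 * m1 ≤ n
    · have hd := Nat.div_add_mod n m1
      have hlt := Nat.mod_lt n (show 0 < m1 by omega)
      have hle : n / m1 ≤ m2 - 2 := Nat.div_le_of_le_mul hn2
      refine ⟨m1, n / m1, n % m1, hd, by omega, Or.inl rfl, hlt, ?_, by omega, ?_⟩
      · rw [Nat.le_div_iff_mul_le (by omega)]; exact hb
      · intro hpos
        have : n / m1 ≠ m2 - 2 := by
          intro h
          rw [h] at hd
          omega
        omega
    · obtain ⟨c, hcdef⟩ : ∃ c, c = min (n / 4) (m1 - 2) := ⟨_, rfl⟩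
      have hd := Nat.div_add_mod n c
      have hlt := Nat.mod_lt n (show 0 < c by omega)
      have h4 : 4 ≤ n / c := by rw [Nat.le_div_iff_mul_le (by omega)]; omega
      have h6 : n / c < 6 := by rw [Nat.div_lt_iff_lt_mul (by omega)]; omega
      exact ⟨c, n / c, n % c, hd, by omega, by omega, hlt, h4, by omega, by omega⟩
  rw [← e]
  rcases Nat.mod_two_eq_zero_or_one h with h0 | h0
  · exact jg_layoutA hc hcm hr hh hm hm' (Or.inl ⟨h0, rfl, rfl⟩)
  · exact jg_layoutA hc hcm hr hh hm hm' (Or.inr ⟨h0, rfl, rfl⟩)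

/-- Occupied cells of the second layout. -/
def jgCD (m1 s p e x y : ℕ) : Prop :=
  (x < m1 ∧ y < s) ∨ (x < p + e ∧ y = s) ∨ (x < p ∧ y = s + 1)

/-- Forced cells of the second layout. -/
def jgCP (m1 s p e x y : ℕ) : Prop :=
  jgCD m1 s p e x y ∧ ((y = s + 1 ∧ (x = 0 ∨ x + 1 = p)) ∨ (y = s ∧ (x = 0 ∨ x + 1 = p + e)) ∨
    (y = 0 ∧ (x = p ∨ x + 1 = m1)) ∨ (y + 1 = s ∧ p + e < m1 ∧ (x = p + e ∨ x + 1 = m1)))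

set_option maxHeartbeats 8000000 in
theorem jg_layoutC {m1 s p e : ℕ} (h1 : 9 ≤ m1) (hs : 7 ≤ s) (he : e ≤ 1) (hpe : 1 ≤ p + e)
    (hpm : p + e ≤ m1) (hp : p < m1) (f g : ℕ → ℕ → ℕ)
    (hmem : ∀ x y, jgCD m1 s p e x y → jgCD m1 s p e (f x y) (g x y))
    (hinv : ∀ x y, jgCD m1 s p e x y → f (f x y) (g x y) = x ∧ g (f x y) (g x y) = y)
    (hadj : ∀ x y, jgCD m1 s p e x y → (f x y = x ∧ g x y = y) ∨
      jgAdj m1 (s + 2) (x, y) (f x y, g x y))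
    (hPP : ∀ x y, jgCP m1 s p e x y → ¬ jgCP m1 s p e (f x y) (g x y))
    (hfix : ∀ x y, jgCD m1 s p e x y → f x y = x → g x y = y →
      (1 ≤ y ∧ y ≤ 5 ∧ x < m1) ∧ ¬ jgCP m1 s p e x (y - 1) ∧
      ¬ jgCP m1 s p e (f x (y - 1)) (g x (y - 1)) ∧ (f x (y - 1) = x → g x (y - 1) = y - 1 → False))
    (huniq : ∀ x y x' y', jgCD m1 s p e x y → jgCD m1 s p e x' y' → f x y = x → g x y = y →
      f x' y' = x' → g x' y' = y' → x = x' ∧ y = y')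
    (X1 X2 Y1 Y2 Z1 Z2 W1 W2 : ℕ)
    (b1 : jgCD m1 s p e X1 X2) (b2 : f X1 X2 = Y1 ∧ g X1 X2 = Y2)
    (b3 : ¬ (X1 = Y1 ∧ X2 = Y2)) (b4 : ¬ jgCP m1 s p e X1 X2) (b5 : ¬ jgCP m1 s p e Y1 Y2)
    (b6 : jgCD m1 s p e Z1 Z2) (b7 : jgCD m1 s p e W1 W2)
    (b8 : jgAdj m1 (s + 2) (X1, X2) (Z1, Z2)) (b9 : jgAdj m1 (s + 2) (Y1, Y2) (W1, W2))
    (b10 : ¬ jgCP m1 s p e Z1 Z2) (b11 : ¬ jgCP m1 s p e W1 W2)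
    (b12 : ¬ (f Z1 Z2 = Z1 ∧ g Z1 Z2 = Z2)) (b13 : ¬ (f W1 W2 = W1 ∧ g W1 W2 = W2))
    (b14 : ¬ (Z1 = X1 ∧ Z2 = X2) ∧ ¬ (Z1 = Y1 ∧ Z2 = Y2) ∧ ¬ (W1 = X1 ∧ W2 = X2) ∧
      ¬ (W1 = Y1 ∧ W2 = Y2))
    (b15 : ¬ (Z1 = W1 ∧ Z2 = W2) ∧ ¬ (Z1 = f W1 W2 ∧ Z2 = g W1 W2))
    (b16 : ∀ x y, jgCD m1 s p e x y → f x y = x → g x y = y →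
      ¬ (x = X1 ∧ y - 1 = X2) ∧ ¬ (x = Y1 ∧ y - 1 = Y2) ∧ ¬ (x = Z1 ∧ y - 1 = Z2) ∧
      ¬ (x = W1 ∧ y - 1 = W2) ∧ ¬ (x = f Z1 Z2 ∧ y - 1 = g Z1 Z2) ∧
      ¬ (x = f W1 W2 ∧ y - 1 = g W1 W2)) :
    ∃ (D : Finset (ℕ × ℕ)) (π y : ℕ × ℕ → ℕ × ℕ) (P : Finset (ℕ × ℕ)) (x1 x2 y1 y2 : ℕ × ℕ),
      #P ≤ 8 ∧ JgBase m1 (s + 2) (m1 * s + (p + e) + p) D π y P x1 x2 y1 y2 := by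
  classical
  set D : Finset (ℕ × ℕ) := Finset.range m1 ×ˢ Finset.range s ∪ Finset.range (p + e) ×ˢ {s} ∪
    Finset.range p ×ˢ {s + 1} with hD
  have mD : ∀ x y, (x, y) ∈ D ↔ jgCD m1 s p e x y := by
    intro x y
    simp only [hD, Finset.mem_union, Finset.mem_product, Finset.mem_range, Finset.mem_singleton,
      jgCD, or_assoc]
  have cD : #D = m1 * s + (p + e) + p := by
    rw [hD, Finset.card_union_of_disjoint, Finset.card_union_of_disjoint]
    · simp
    · rw [Finset.disjoint_left]
      rintro ⟨x, y⟩ h1 h2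
      simp only [Finset.mem_product, Finset.mem_range, Finset.mem_singleton] at h1 h2
      omega
    · rw [Finset.disjoint_left]
      rintro ⟨x, y⟩ h1 h2
      simp only [Finset.mem_union, Finset.mem_product, Finset.mem_range,
        Finset.mem_singleton] at h1 h2
      omega
  set P : Finset (ℕ × ℕ) :=
    {u ∈ ({(0, s + 1), (p - 1, s + 1), (0, s), (p + e - 1, s), (p, 0), (m1 - 1, 0),
      (p + e, s - 1), (m1 - 1, s - 1)} : Finset (ℕ × ℕ)) | jgCP m1 s p e u.1 u.2} with hP
  have mP : ∀ x y, (x, y) ∈ P ↔ jgCP m1 s p e x y := by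
    intro x y
    rw [hP, Finset.mem_filter]
    simp only [Finset.mem_insert, Finset.mem_singleton, Prod.mk.injEq]
    refine ⟨fun h => h.2, fun h => ⟨?_, h⟩⟩
    unfold jgCP at h
    omega
  have cP : #P ≤ 8 := by
    refine (Finset.card_filter_le _ _).trans ?_
    refine (Finset.card_insert_le _ _).trans ?_
    refine Nat.succ_le_succ ?_
    refine (Finset.card_insert_le _ _).trans ?_
    refine Nat.succ_le_succ ?_
    exact Finset.card_le_six
  set π : ℕ × ℕ → ℕ × ℕ := fun u => (f u.1 u.2, g u.1 u.2) with hπ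
  have eπ : ∀ x y, π (x, y) = (f x y, g x y) := fun x y => rfl
  set yf : ℕ × ℕ → ℕ × ℕ := fun u => (u.1, u.2 - 1) with hyf
  have eyf : ∀ x y, yf (x, y) = (x, y - 1) := fun x y => rfl
  have cls : ∀ a b x y, a < m1 → b < s + 2 → ¬ jgCD m1 s p e a b → jgCD m1 s p e x y →
      jgAdj m1 (s + 2) (a, b) (x, y) →
      (x = a ∧ y + 1 = s ∧ b = s ∧ p + e ≤ a) ∨
      (x = a ∧ y = s ∧ b = s + 1 ∧ a = p ∧ e = 1) ∨
      (x = a ∧ y = 0 ∧ b = s + 1 ∧ p ≤ a) ∨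
      (x + 1 = a ∧ y = s ∧ b = s ∧ a = p + e) ∨
      (x + 1 = a ∧ y = s + 1 ∧ b = s + 1 ∧ a = p) ∨
      (x = 0 ∧ a + 1 = m1 ∧ y = s ∧ b = s ∧ p + e ≤ a) ∨
      (x = 0 ∧ a + 1 = m1 ∧ y = s + 1 ∧ b = s + 1 ∧ p ≤ a ∧ 1 ≤ p) := by
    intro a b x y h1 h2 hw hu hA
    unfold jgCD at hw hu
    unfold jgAdj jgCyc at hA
    simp only at hA
    have hb : (b = s ∧ p + e ≤ a) ∨ (b = s + 1 ∧ p ≤ a) := by omega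
    clear hw
    rcases hA with ⟨e1, e2 | e2 | e2 | e2⟩ | ⟨e1, e2 | e2 | e2 | e2⟩ <;>
    rcases hb with hb | hb <;> rcases hu with hu | hu | hu <;> omega
  have emp : ∀ w : ℕ × ℕ, w.1 < m1 → w.2 < s + 2 → w ∉ D → ∀ u ∈ D, ∀ v ∈ D,
      jgAdj m1 (s + 2) w u → jgAdj m1 (s + 2) w v → u ≠ v → u ∈ P ∧ v ∈ P := by
    rintro ⟨a, b⟩ h1 h2 hw ⟨x, y⟩ hu ⟨x', y'⟩ hv hA hA' hne
    rw [mD] at hw hu hv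
    have hA := cls a b x y h1 h2 hw hu hA
    have hA' := cls a b x' y' h1 h2 hw hv hA'
    rw [mP, mP]
    rw [Ne, Prod.mk.injEq] at hne
    simp only at h1 h2
    have hP1 : ∀ x y, jgCD m1 s p e x y → ((y = s + 1 ∧ (x = 0 ∨ x + 1 = p)) ∨
      (y = s ∧ (x = 0 ∨ x + 1 = p + e)) ∨
      (y = 0 ∧ (x = p ∨ x + 1 = m1)) ∨ (y + 1 = s ∧ p + e < m1 ∧ (x = p + e ∨ x + 1 = m1))) →
      jgCP m1 s p e x y := fun x y h h' => ⟨h, h'⟩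
    refine ⟨hP1 _ _ hu ?_, hP1 _ _ hv ?_⟩ <;>
    clear hP1 hw hu hv cls b1 b2 b3 b14 b15 hD mD mP cD cP eπ eyf <;>
    rcases hA with e | e | e | e | e | e | e <;> rcases hA' with f | f | f | f | f | f | f <;> omega
  refine ⟨D, π, yf, P, (X1, X2), (Y1, Y2), (Z1, Z2), (W1, W2), cP, ?_⟩
  refine ⟨?_, cD, ?_, ?_, ?_, ?_, ?_, ?_, ?_, ?_, ?_, ?_, ?_, emp, (mD _ _).2 b1, ?_, ?_, ?_, ?_,
    (mD _ _).2 b6, (mD _ _).2 b7, b8, b9, ?_, ?_, ?_, ?_, ?_, ?_, ?_⟩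
  · rintro ⟨x, y⟩ hu
    rw [mD] at hu
    unfold jgCD at hu
    simp only
    omega
  · rintro ⟨x, y⟩ hu
    rw [mD] at hu
    rw [eπ, mD]
    exact hmem x y hu
  · rintro ⟨x, y⟩ hu
    rw [mD] at hu
    rw [eπ, Prod.mk.injEq]
    exact hinv x y hu
  · rintro ⟨x, y⟩ hu h
    rw [mD] at hu
    rw [eπ, Ne, Prod.mk.injEq] at h
    exact (hadj x y hu).resolve_left h
  · rintro ⟨x, y⟩ hu
    rw [mP] at hu
    rw [mD]
    exact hu.1
  · rintro ⟨x, y⟩ hu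
    rw [mP] at hu
    rw [eπ, mP]
    exact hPP x y hu
  · rintro ⟨x, y⟩ hu h
    rw [mD] at hu
    rw [eπ, Prod.mk.injEq] at h
    have := hfix x y hu h.1 h.2
    rw [eyf, mD]
    left
    omega
  · rintro ⟨x, y⟩ hu h
    rw [mD] at hu
    rw [eπ, Prod.mk.injEq] at h
    have := hfix x y hu h.1 h.2
    rw [eyf]
    refine Or.inl ⟨rfl, Or.inr (Or.inl ?_)⟩
    simp only
    omega
  · rintro ⟨x, y⟩ hu h
    rw [mD] at hu
    rw [eπ, Prod.mk.injEq] at h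
    rw [eyf, mP]
    exact (hfix x y hu h.1 h.2).2.1
  · rintro ⟨x, y⟩ hu h
    rw [mD] at hu
    rw [eπ, Prod.mk.injEq] at h
    rw [eyf, eπ, mP]
    exact (hfix x y hu h.1 h.2).2.2.1
  · rintro ⟨x, y⟩ hu h
    rw [mD] at hu
    rw [eπ, Prod.mk.injEq] at h
    rw [eyf, eπ, Ne, Prod.mk.injEq]
    exact fun h' => (hfix x y hu h.1 h.2).2.2.2 h'.1 h'.2
  · rintro ⟨x, y⟩ hu ⟨x', y'⟩ hv h h'
    rw [mD] at hu hv
    rw [eπ, Prod.mk.injEq] at h h'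
    rw [Prod.mk.injEq]
    exact huniq x y x' y' hu hv h.1 h.2 h'.1 h'.2
  · rw [eπ, Prod.mk.injEq]; exact b2
  · rw [Ne, Prod.mk.injEq]; exact b3
  · rw [mP]; exact b4
  · rw [mP]; exact b5
  · rw [mP]; exact b10
  · rw [mP]; exact b11
  · rw [eπ, Ne, Prod.mk.injEq]; exact b12
  · rw [eπ, Ne, Prod.mk.injEq]; exact b13
  · simp only [Ne, Prod.mk.injEq]; exact b14
  · simp only [eπ, Ne, Prod.mk.injEq]; exact b15
  · rintro ⟨x, y⟩ hu h
    rw [mD] at hu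
    rw [eπ, Prod.mk.injEq] at h
    simp only [eyf, eπ, Ne, Prod.mk.injEq]
    exact b16 x y hu h.1 h.2


/-- Partner relation of the second layout, even height. -/
def jgRE (s p e x y a b : ℕ) : Prop :=
  a = x ∧ ((x < p ∧ y = 0 ∧ b = s + 1) ∨ (x < p ∧ y ≠ 0 ∧ y = s + 1 ∧ b = 0) ∨
    (x < p ∧ y ≠ 0 ∧ y ≠ s + 1 ∧ y % 2 = 1 ∧ b = y + 1) ∨
    (x < p ∧ y ≠ 0 ∧ y ≠ s + 1 ∧ y % 2 = 0 ∧ b + 1 = y) ∨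
    (p ≤ x ∧ x < p + e ∧ 4 < y ∧ y % 2 = 1 ∧ b = y + 1) ∨
    (p ≤ x ∧ x < p + e ∧ 4 < y ∧ y % 2 = 0 ∧ b + 1 = y) ∨
    (p ≤ x ∧ x < p + e ∧ y = 4 ∧ b = 4) ∨
    (p ≤ x ∧ (p + e ≤ x ∨ y < 4) ∧ y % 2 = 0 ∧ b = y + 1) ∨
    (p ≤ x ∧ (p + e ≤ x ∨ y < 4) ∧ y % 2 = 1 ∧ b + 1 = y))

theorem jgRE_spec (s p e x y a b : ℕ) (ha : a = x)
    (hb : b = (fun x y =>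
      if x < p then
        if y = 0 then s + 1 else if y = s + 1 then 0 else if y % 2 = 1 then y + 1 else y - 1
      else if x < p + e ∧ 4 < y then (if y % 2 = 1 then y + 1 else y - 1)
      else if x < p + e ∧ y = 4 then 4
      else if y % 2 = 0 then y + 1 else y - 1) x y) : jgRE s p e x y a b := by
  simp only at hb
  refine ⟨ha, ?_⟩
  split_ifs at hb
  all_goals
    first
      | exact Or.inl (by omega)
      | exact Or.inr (Or.inl (by omega))
      | exact Or.inr (Or.inr (Or.inl (by omega)))
      | exact Or.inr (Or.inr (Or.inr (Or.inl (by omega))))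
      | exact Or.inr (Or.inr (Or.inr (Or.inr (Or.inl (by omega)))))
      | exact Or.inr (Or.inr (Or.inr (Or.inr (Or.inr (Or.inl (by omega))))))
      | exact Or.inr (Or.inr (Or.inr (Or.inr (Or.inr (Or.inr (Or.inl (by omega)))))))
      | exact Or.inr (Or.inr (Or.inr (Or.inr (Or.inr (Or.inr (Or.inr (Or.inl (by omega))))))))
      | exact Or.inr (Or.inr (Or.inr (Or.inr (Or.inr (Or.inr (Or.inr (Or.inr (by omega))))))))

set_option maxHeartbeats 8000000 in
theorem jgRE_mem {m1 s p e : ℕ} (h1 : 9 ≤ m1) (hs : 7 ≤ s) (he : e ≤ 1) (hpe : 1 ≤ p + e)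
    (hpm : p + e ≤ m1) (hp : p < m1) (hpar : s % 2 = 0)
    (x y a b : ℕ) (h : jgCD m1 s p e x y) (h2 : jgRE s p e x y a b) :
    jgCD m1 s p e a b := by
  unfold jgCD at h ⊢
  unfold jgRE at h2
  obtain ⟨hax, h2⟩ := h2
  subst hax
  rcases h2 with h2 | h2 | h2 | h2 | h2 | h2 | h2 | h2 | h2 <;> omega

set_option maxHeartbeats 8000000 in
theorem jgRE_inv {m1 s p e : ℕ} (h1 : 9 ≤ m1) (hs : 7 ≤ s) (he : e ≤ 1) (hpe : 1 ≤ p + e)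
    (hpm : p + e ≤ m1) (hp : p < m1) (hpar : s % 2 = 0)
    (x y a b c d : ℕ) (h : jgCD m1 s p e x y) (h2 : jgRE s p e x y a b)
    (h3 : jgRE s p e a b c d) : c = x ∧ d = y := by
  unfold jgCD at h
  unfold jgRE at h2 h3
  obtain ⟨hax, h2⟩ := h2
  obtain ⟨hac, h3⟩ := h3
  subst hax hac
  refine ⟨rfl, ?_⟩
  rcases h2 with h2 | h2 | h2 | h2 | h2 | h2 | h2 | h2 | h2 <;>
  rcases h3 with h3 | h3 | h3 | h3 | h3 | h3 | h3 | h3 | h3 <;>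
  omega

set_option maxHeartbeats 8000000 in
theorem jgRE_adj {m1 s p e : ℕ} (h1 : 9 ≤ m1) (hs : 7 ≤ s) (he : e ≤ 1) (hpe : 1 ≤ p + e)
    (hpm : p + e ≤ m1) (hp : p < m1) (hpar : s % 2 = 0)
    (x y a b : ℕ) (h : jgCD m1 s p e x y) (h2 : jgRE s p e x y a b) :
    (a = x ∧ b = y) ∨ jgAdj m1 (s + 2) (x, y) (a, b) := by
  unfold jgCD at h
  unfold jgRE at h2
  obtain ⟨hax, h2⟩ := h2
  have h3 : b = y ∨ b = y + 1 ∨ y = b + 1 ∨ (y = 0 ∧ b = s + 1) ∨ (b = 0 ∧ y = s + 1) := by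
    clear h
    rcases h2 with h2 | h2 | h2 | h2 | h2 | h2 | h2 | h2 | h2 <;> omega
  unfold jgAdj jgCyc
  simp only
  clear h2 h
  omega

set_option maxHeartbeats 8000000 in
theorem jgRE_PP {m1 s p e : ℕ} (h1 : 9 ≤ m1) (hs : 7 ≤ s) (he : e ≤ 1) (hpe : 1 ≤ p + e)
    (hpm : p + e ≤ m1) (hp : p < m1) (hpar : s % 2 = 0)
    (x y a b : ℕ) (h : jgCP m1 s p e x y) (h5 : jgCP m1 s p e a b)
    (h2 : jgRE s p e x y a b) : False := by
  unfold jgCP jgCD at h h5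
  unfold jgRE at h2
  obtain ⟨ha, hb⟩ := h
  obtain ⟨hc, hd⟩ := h5
  have hb' : y = s + 1 ∨ y = s ∨ y = 0 ∨ y + 1 = s := by omega
  have hd' : b = s + 1 ∨ b = s ∨ b = 0 ∨ b + 1 = s := by omega
  obtain ⟨hax, h2⟩ := h2
  subst hax
  rcases h2 with h2 | h2 | h2 | h2 | h2 | h2 | h2 | h2 | h2 <;>
  first
    | (clear hb hd ha hc; omega)
    | (rcases hb with hb | hb | hb | hb <;> rcases hd with hd | hd | hd | hd <;> omega)

set_option maxHeartbeats 8000000 in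
theorem jgRE_loc {m1 s p e : ℕ} (h1 : 9 ≤ m1) (hs : 7 ≤ s) (he : e ≤ 1) (hpe : 1 ≤ p + e)
    (hpm : p + e ≤ m1) (hp : p < m1) (hpar : s % 2 = 0)
    (x y : ℕ) (h : jgCD m1 s p e x y) (h2 : jgRE s p e x y x y) :
    x = p ∧ y = 4 ∧ e = 1 := by
  unfold jgCD at h
  unfold jgRE at h2
  obtain ⟨hax, h2⟩ := h2
  rcases h2 with h2 | h2 | h2 | h2 | h2 | h2 | h2 | h2 | h2 <;> omega

set_option maxHeartbeats 8000000 in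
theorem jgRE_fix {m1 s p e : ℕ} (h1 : 9 ≤ m1) (hs : 7 ≤ s) (he : e ≤ 1) (hpe : 1 ≤ p + e)
    (hpm : p + e ≤ m1) (hp : p < m1) (hpar : s % 2 = 0)
    (x y a b : ℕ) (hl : x = p ∧ y = 4 ∧ e = 1) (h2 : jgRE s p e x (y - 1) a b) :
    (1 ≤ y ∧ y ≤ 5 ∧ x < m1) ∧ ¬ jgCP m1 s p e x (y - 1) ∧ ¬ jgCP m1 s p e a b ∧
      (a = x → b = y - 1 → False) := by
  have h3 : a = x ∧ b = 2 := by
    unfold jgRE at h2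
    obtain ⟨hax, h2⟩ := h2
    rcases h2 with h2 | h2 | h2 | h2 | h2 | h2 | h2 | h2 | h2 <;> omega
  clear h2
  unfold jgCP jgCD
  refine ⟨by omega, ?_, ?_, by omega⟩
  · rintro ⟨ha, hb⟩
    omega
  · rintro ⟨ha, hb⟩
    omega

set_option maxHeartbeats 8000000 in
theorem jg_layoutCE {m1 s p e : ℕ} (h1 : 9 ≤ m1) (hs : 7 ≤ s) (he : e ≤ 1) (hpe : 1 ≤ p + e)
    (hpm : p + e ≤ m1) (hp : p < m1) (hpar : s % 2 = 0) :
    ∃ (D : Finset (ℕ × ℕ)) (π y : ℕ × ℕ → ℕ × ℕ) (P : Finset (ℕ × ℕ)) (x1 x2 y1 y2 : ℕ × ℕ),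
      #P ≤ 8 ∧ JgBase m1 (s + 2) (m1 * s + (p + e) + p) D π y P x1 x2 y1 y2 := by
  obtain ⟨f, hf⟩ : ∃ f : ℕ → ℕ → ℕ, f = fun x _ => x := ⟨_, rfl⟩
  obtain ⟨g, hg⟩ : ∃ g : ℕ → ℕ → ℕ, g = fun x y =>
      if x < p then
        if y = 0 then s + 1 else if y = s + 1 then 0 else if y % 2 = 1 then y + 1 else y - 1
      else if x < p + e ∧ 4 < y then (if y % 2 = 1 then y + 1 else y - 1)
      else if x < p + e ∧ y = 4 then 4
      else if y % 2 = 0 then y + 1 else y - 1 := ⟨_, rfl⟩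
  have spec : ∀ x y, jgRE s p e x y (f x y) (g x y) := fun x y =>
    jgRE_spec s p e x y _ _ (by rw [hf]) (by rw [hg])
  clear hf hg
  have hmem : ∀ x y, jgCD m1 s p e x y → jgCD m1 s p e (f x y) (g x y) := fun x y h =>
    jgRE_mem h1 hs he hpe hpm hp hpar x y _ _ h (spec x y)
  have hinv : ∀ x y, jgCD m1 s p e x y →
      f (f x y) (g x y) = x ∧ g (f x y) (g x y) = y := fun x y h =>
    jgRE_inv h1 hs he hpe hpm hp hpar x y _ _ _ _ h (spec x y) (spec _ _)
  have hadj : ∀ x y, jgCD m1 s p e x y → (f x y = x ∧ g x y = y) ∨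
      jgAdj m1 (s + 2) (x, y) (f x y, g x y) := fun x y h =>
    jgRE_adj h1 hs he hpe hpm hp hpar x y _ _ h (spec x y)
  have hPP : ∀ x y, jgCP m1 s p e x y → ¬ jgCP m1 s p e (f x y) (g x y) := fun x y h h5 =>
    jgRE_PP h1 hs he hpe hpm hp hpar x y _ _ h h5 (spec x y)
  have hloc : ∀ x y, jgCD m1 s p e x y → f x y = x → g x y = y → x = p ∧ y = 4 ∧ e = 1 := by
    intro x y h h3 h4
    have h2 := spec x y
    rw [h3, h4] at h2
    exact jgRE_loc h1 hs he hpe hpm hp hpar x y h h2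
  have hfix : ∀ x y, jgCD m1 s p e x y → f x y = x → g x y = y →
      (1 ≤ y ∧ y ≤ 5 ∧ x < m1) ∧ ¬ jgCP m1 s p e x (y - 1) ∧
      ¬ jgCP m1 s p e (f x (y - 1)) (g x (y - 1)) ∧
      (f x (y - 1) = x → g x (y - 1) = y - 1 → False) := by
    intro x y h h3 h4
    exact jgRE_fix h1 hs he hpe hpm hp hpar x y _ _ (hloc x y h h3 h4) (spec x (y - 1))
  have huniq : ∀ x y x' y', jgCD m1 s p e x y → jgCD m1 s p e x' y' → f x y = x → g x y = y →
      f x' y' = x' → g x' y' = y' → x = x' ∧ y = y' := by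
    intro x y x' y' h h' h3 h4 h5 h6
    have hl := hloc x y h h3 h4
    have hl' := hloc x' y' h' h5 h6
    omega
  by_cases hp2 : 2 ≤ p
  · have e1 : f 0 3 = 0 ∧ g 0 3 = 4 := by
      have h2 := spec 0 3
      unfold jgRE at h2
      omega
    have e2 : f 0 2 = 0 ∧ g 0 2 = 1 := by
      have h2 := spec 0 2
      unfold jgRE at h2
      omega
    have e3 : f 0 5 = 0 ∧ g 0 5 = 6 := by
      have h2 := spec 0 5
      unfold jgRE at h2
      omega
    refine jg_layoutC h1 hs he hpe hpm hp f g hmem hinv hadj hPP hfix huniq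
      0 3 0 4 0 2 0 5 ?_ e1 ?_ ?_ ?_ ?_ ?_ (Or.inl ⟨rfl, Or.inr (Or.inl rfl)⟩)
      (Or.inl ⟨rfl, Or.inl rfl⟩) ?_ ?_ ?_ ?_ ?_ ?_ ?_
    all_goals try (unfold jgCP jgCD; omega)
    all_goals try (unfold jgCD; omega)
    all_goals try omega
    intro x y h h3 h4
    have hl := hloc x y h h3 h4
    omega
  · obtain ⟨k, hk⟩ : ∃ k, k = p + e := ⟨_, rfl⟩
    have e1 : f k 2 = k ∧ g k 2 = 3 := by
      have h2 := spec k 2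
      unfold jgRE at h2
      omega
    have e2 : f (k + 1) 2 = k + 1 ∧ g (k + 1) 2 = 3 := by
      have h2 := spec (k + 1) 2
      unfold jgRE at h2
      omega
    have e3 : f k 4 = k ∧ g k 4 = 5 := by
      have h2 := spec k 4
      unfold jgRE at h2
      omega
    refine jg_layoutC h1 hs he hpe hpm hp f g hmem hinv hadj hPP hfix huniq
      k 2 k 3 (k + 1) 2 k 4 ?_ e1 ?_ ?_ ?_ ?_ ?_ (Or.inr ⟨rfl, Or.inl rfl⟩)
      (Or.inl ⟨rfl, Or.inl rfl⟩) ?_ ?_ ?_ ?_ ?_ ?_ ?_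
    all_goals try (unfold jgCP jgCD; omega)
    all_goals try (unfold jgCD; omega)
    all_goals try omega
    intro x y h h3 h4
    have hl := hloc x y h h3 h4
    omega


/-- Partner relation of the second layout, odd height and odd width. -/
def jgRO (m1 s p e k4 k5 x y a b : ℕ) : Prop :=
  (y = 5 ∧ x < k5 ∧ x % 2 = 1 ∧ a + 1 = x ∧ b = 5) ∨
  (y = 5 ∧ x + 1 < k5 ∧ x % 2 = 0 ∧ a = x + 1 ∧ b = 5) ∨
  (y = 5 ∧ x < k5 ∧ k5 ≤ x + 1 ∧ x % 2 = 0 ∧ a = x ∧ b = 5) ∨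
  (y = 4 ∧ k4 ≤ x ∧ (x + k4) % 2 = 1 ∧ a + 1 = x ∧ b = 4) ∨
  (y = 4 ∧ k4 ≤ x ∧ x + 1 < m1 ∧ (x + k4) % 2 = 0 ∧ a = x + 1 ∧ b = 4) ∨
  (y = 4 ∧ k4 ≤ x ∧ m1 ≤ x + 1 ∧ (x + k4) % 2 = 0 ∧ a = x ∧ b = 4) ∨
  (¬ (y = 5 ∧ x < k5) ∧ ¬ (y = 4 ∧ k4 ≤ x) ∧ a = x ∧
    ((x < p ∧ y = 0 ∧ b = s + 1) ∨ (x < p ∧ y ≠ 0 ∧ y = s + 1 ∧ b = 0) ∨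
    (x < p ∧ y ≠ 0 ∧ y ≠ s + 1 ∧ ((y % 2 = 1 ∧ y ≤ 4) ∨ (y % 2 = 0 ∧ 4 < y)) ∧ b = y + 1) ∨
    (x < p ∧ y ≠ 0 ∧ y ≠ s + 1 ∧ ((y % 2 = 0 ∧ y ≤ 4) ∨ (y % 2 = 1 ∧ 4 < y)) ∧ b + 1 = y) ∨
    (p ≤ x ∧ (x < p + e ∨ y < 4) ∧ y % 2 = 0 ∧ b = y + 1) ∨
    (p ≤ x ∧ (x < p + e ∨ y < 4) ∧ y % 2 = 1 ∧ b + 1 = y) ∨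
    (p + e ≤ x ∧ 4 ≤ y ∧ y % 2 = 1 ∧ b = y + 1) ∨
    (p + e ≤ x ∧ 4 ≤ y ∧ y % 2 = 0 ∧ b + 1 = y)))

theorem jgRO_spec (m1 s p e k4 k5 x y a b : ℕ) (he : e ≤ 1) (hs : 7 ≤ s) (hk : (e = 1 ∧ p % 2 = 1 ∧ k5 = p + 1 ∧ k4 = p) ∨ (e = 1 ∧ p % 2 = 0 ∧ k5 = p ∧ k4 = p + 1) ∨
      (e = 0 ∧ k5 = p ∧ k4 = p))
    (ha : a = (fun x y =>
      if y = 5 ∧ x < k5 then (if x % 2 = 1 then x - 1 else if x + 1 < k5 then x + 1 else x)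
      else if y = 4 ∧ k4 ≤ x then
        (if (x + k4) % 2 = 1 then x - 1 else if x + 1 < m1 then x + 1 else x)
      else x) x y)
    (hb : b = (fun x y =>
      if y = 5 ∧ x < k5 then 5
      else if y = 4 ∧ k4 ≤ x then 4
      else if x < p then
        if y = 0 then s + 1 else if y = s + 1 then 0
        else if (y % 2 = 1 ∧ y ≤ 4) ∨ (y % 2 = 0 ∧ 4 < y) then y + 1 else y - 1
      else if x < p + e ∨ y < 4 then (if y % 2 = 0 then y + 1 else y - 1)
      else if y % 2 = 1 then y + 1 else y - 1) x y) : jgRO m1 s p e k4 k5 x y a b := by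
  simp only at ha hb
  unfold jgRO
  split_ifs at ha hb
  all_goals
    first
      | exact Or.inl ⟨by omega, by omega, by omega, by omega, by omega⟩
      | exact Or.inr (Or.inl ⟨by omega, by omega, by omega, by omega, by omega⟩)
      | exact Or.inr (Or.inr (Or.inl ⟨by omega, by omega, by omega, by omega, by omega, by omega⟩))
      | exact Or.inr (Or.inr (Or.inr (Or.inl ⟨by omega, by omega, by omega, by omega, by omega⟩)))
      | exact Or.inr (Or.inr (Or.inr (Or.inr (Or.inl ⟨by omega, by omega, by omega, by omega, by omega, by omega⟩))))
      | exact Or.inr (Or.inr (Or.inr (Or.inr (Or.inr (Or.inl ⟨by omega, by omega, by omega, by omega, by omega, by omega⟩)))))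
      | exact Or.inr (Or.inr (Or.inr (Or.inr (Or.inr (Or.inr (⟨by omega, by omega, by omega, Or.inl (by omega)⟩))))))
      | exact Or.inr (Or.inr (Or.inr (Or.inr (Or.inr (Or.inr (⟨by omega, by omega, by omega, Or.inr (Or.inl (by omega))⟩))))))
      | exact Or.inr (Or.inr (Or.inr (Or.inr (Or.inr (Or.inr (⟨by omega, by omega, by omega, Or.inr (Or.inr (Or.inl (by omega)))⟩))))))
      | exact Or.inr (Or.inr (Or.inr (Or.inr (Or.inr (Or.inr (⟨by omega, by omega, by omega, Or.inr (Or.inr (Or.inr (Or.inl (by omega))))⟩))))))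
      | exact Or.inr (Or.inr (Or.inr (Or.inr (Or.inr (Or.inr (⟨by omega, by omega, by omega, Or.inr (Or.inr (Or.inr (Or.inr (Or.inl (by omega)))))⟩))))))
      | exact Or.inr (Or.inr (Or.inr (Or.inr (Or.inr (Or.inr (⟨by omega, by omega, by omega, Or.inr (Or.inr (Or.inr (Or.inr (Or.inr (Or.inl (by omega))))))⟩))))))
      | exact Or.inr (Or.inr (Or.inr (Or.inr (Or.inr (Or.inr (⟨by omega, by omega, by omega, Or.inr (Or.inr (Or.inr (Or.inr (Or.inr (Or.inr (Or.inl (by omega)))))))⟩))))))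
      | exact Or.inr (Or.inr (Or.inr (Or.inr (Or.inr (Or.inr (⟨by omega, by omega, by omega, Or.inr (Or.inr (Or.inr (Or.inr (Or.inr (Or.inr (Or.inr (by omega)))))))⟩))))))

set_option maxHeartbeats 8000000 in
theorem jgRO_mem {m1 s p e k4 k5 : ℕ} (h1 : 9 ≤ m1) (hs : 7 ≤ s) (he : e ≤ 1) (hpe : 1 ≤ p + e)
    (hpm : p + e ≤ m1) (hp : p < m1) (hpar : s % 2 = 1) (hparm : m1 % 2 = 1)
    (hk : (e = 1 ∧ p % 2 = 1 ∧ k5 = p + 1 ∧ k4 = p) ∨ (e = 1 ∧ p % 2 = 0 ∧ k5 = p ∧ k4 = p + 1) ∨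
      (e = 0 ∧ k5 = p ∧ k4 = p))
    (x y a b : ℕ) (h : jgCD m1 s p e x y) (h2 : jgRO m1 s p e k4 k5 x y a b) :
    jgCD m1 s p e a b := by
  unfold jgCD at h ⊢
  unfold jgRO at h2
  rcases h2 with h2 | h2 | h2 | h2 | h2 | h2 | ⟨h6, h7, h8, h2 | h2 | h2 | h2 | h2 | h2 | h2 | h2⟩ <;>
  rcases hk with hk | hk | hk <;> omega

set_option maxHeartbeats 8000000 in
theorem jgRO_inv {m1 s p e k4 k5 : ℕ} (h1 : 9 ≤ m1) (hs : 7 ≤ s) (he : e ≤ 1) (hpe : 1 ≤ p + e)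
    (hpm : p + e ≤ m1) (hp : p < m1) (hpar : s % 2 = 1) (hparm : m1 % 2 = 1)
    (hk : (e = 1 ∧ p % 2 = 1 ∧ k5 = p + 1 ∧ k4 = p) ∨ (e = 1 ∧ p % 2 = 0 ∧ k5 = p ∧ k4 = p + 1) ∨
      (e = 0 ∧ k5 = p ∧ k4 = p))
    (x y a b c d : ℕ) (h : jgCD m1 s p e x y) (h2 : jgRO m1 s p e k4 k5 x y a b)
    (h3 : jgRO m1 s p e k4 k5 a b c d) : c = x ∧ d = y := by
  unfold jgCD at h
  unfold jgRO at h2 h3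
  rcases h2 with h2 | h2 | h2 | h2 | h2 | h2 | ⟨h6, h7, h8, h2 | h2 | h2 | h2 | h2 | h2 | h2 | h2⟩ <;>
  rcases h3 with h3 | h3 | h3 | h3 | h3 | h3 | ⟨g6, g7, g8, h3 | h3 | h3 | h3 | h3 | h3 | h3 | h3⟩ <;>
  first
    | (exfalso; omega)
    | (constructor <;> omega)

set_option maxHeartbeats 8000000 in
theorem jgRO_adj {m1 s p e k4 k5 : ℕ} (h1 : 9 ≤ m1) (hs : 7 ≤ s) (he : e ≤ 1) (hpe : 1 ≤ p + e)
    (hpm : p + e ≤ m1) (hp : p < m1) (hpar : s % 2 = 1) (hparm : m1 % 2 = 1)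
    (hk : (e = 1 ∧ p % 2 = 1 ∧ k5 = p + 1 ∧ k4 = p) ∨ (e = 1 ∧ p % 2 = 0 ∧ k5 = p ∧ k4 = p + 1) ∨
      (e = 0 ∧ k5 = p ∧ k4 = p))
    (x y a b : ℕ) (h : jgCD m1 s p e x y) (h2 : jgRO m1 s p e k4 k5 x y a b) :
    (a = x ∧ b = y) ∨ jgAdj m1 (s + 2) (x, y) (a, b) := by
  unfold jgCD at h
  unfold jgRO at h2
  have h3 : (a = x ∧ b = y) ∨ (x = a ∧ (b = y + 1 ∨ y = b + 1 ∨ (y = 0 ∧ b = s + 1) ∨ (b = 0 ∧ y = s + 1))) ∨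
      (y = b ∧ (a = x + 1 ∨ x = a + 1)) := by
    clear h
    rcases h2 with h2 | h2 | h2 | h2 | h2 | h2 | ⟨h6, h7, h8, h2 | h2 | h2 | h2 | h2 | h2 | h2 | h2⟩ <;> omega
  unfold jgAdj jgCyc
  simp only
  clear h2 h hk
  omega

set_option maxHeartbeats 8000000 in
theorem jgRO_PP {m1 s p e k4 k5 : ℕ} (h1 : 9 ≤ m1) (hs : 7 ≤ s) (he : e ≤ 1) (hpe : 1 ≤ p + e)
    (hpm : p + e ≤ m1) (hp : p < m1) (hpar : s % 2 = 1) (hparm : m1 % 2 = 1)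
    (hk : (e = 1 ∧ p % 2 = 1 ∧ k5 = p + 1 ∧ k4 = p) ∨ (e = 1 ∧ p % 2 = 0 ∧ k5 = p ∧ k4 = p + 1) ∨
      (e = 0 ∧ k5 = p ∧ k4 = p))
    (x y a b : ℕ) (h : jgCP m1 s p e x y) (h5 : jgCP m1 s p e a b)
    (h2 : jgRO m1 s p e k4 k5 x y a b) : False := by
  unfold jgCP jgCD at h h5
  unfold jgRO at h2
  obtain ⟨ha, hb⟩ := h
  obtain ⟨hc, hd⟩ := h5
  have hb' : y = s + 1 ∨ y = s ∨ y = 0 ∨ y + 1 = s := by omega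
  have hd' : b = s + 1 ∨ b = s ∨ b = 0 ∨ b + 1 = s := by omega
  rcases h2 with h2 | h2 | h2 | h2 | h2 | h2 | ⟨h6, h7, h8, h2 | h2 | h2 | h2 | h2 | h2 | h2 | h2⟩ <;>
  first
    | (clear hb hd ha hc; omega)
    | (rcases hb with hb | hb | hb | hb <;> rcases hd with hd | hd | hd | hd <;> omega)

set_option maxHeartbeats 8000000 in
theorem jgRO_loc {m1 s p e k4 k5 : ℕ} (h1 : 9 ≤ m1) (hs : 7 ≤ s) (he : e ≤ 1) (hpe : 1 ≤ p + e)
    (hpm : p + e ≤ m1) (hp : p < m1) (hpar : s % 2 = 1) (hparm : m1 % 2 = 1)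
    (hk : (e = 1 ∧ p % 2 = 1 ∧ k5 = p + 1 ∧ k4 = p) ∨ (e = 1 ∧ p % 2 = 0 ∧ k5 = p ∧ k4 = p + 1) ∨
      (e = 0 ∧ k5 = p ∧ k4 = p))
    (x y : ℕ) (h : jgCD m1 s p e x y) (h2 : jgRO m1 s p e k4 k5 x y x y) : e = 0 ∧
      ((y = 5 ∧ p % 2 = 1 ∧ x + 1 = p) ∨ (y = 4 ∧ p % 2 = 0 ∧ x + 1 = m1)) := by
  unfold jgCD at h
  unfold jgRO at h2
  rcases h2 with h2 | h2 | h2 | h2 | h2 | h2 | ⟨h6, h7, h8, h2 | h2 | h2 | h2 | h2 | h2 | h2 | h2⟩ <;> omega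

set_option maxHeartbeats 8000000 in
theorem jgRO_fix {m1 s p e k4 k5 : ℕ} (h1 : 9 ≤ m1) (hs : 7 ≤ s) (he : e ≤ 1) (hpe : 1 ≤ p + e)
    (hpm : p + e ≤ m1) (hp : p < m1) (hpar : s % 2 = 1) (hparm : m1 % 2 = 1)
    (hk : (e = 1 ∧ p % 2 = 1 ∧ k5 = p + 1 ∧ k4 = p) ∨ (e = 1 ∧ p % 2 = 0 ∧ k5 = p ∧ k4 = p + 1) ∨
      (e = 0 ∧ k5 = p ∧ k4 = p))
    (x y a b : ℕ) (h0 : e = 0)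
    (hl : (y = 5 ∧ p % 2 = 1 ∧ x + 1 = p) ∨ (y = 4 ∧ p % 2 = 0 ∧ x + 1 = m1))
    (h2 : jgRO m1 s p e k4 k5 x (y - 1) a b) :
    (1 ≤ y ∧ y ≤ 5 ∧ x < m1) ∧ ¬ jgCP m1 s p e x (y - 1) ∧ ¬ jgCP m1 s p e a b ∧
      (a = x → b = y - 1 → False) := by
  have h3 : a = x ∧ ((y = 5 ∧ b = 3) ∨ (y = 4 ∧ b = 2)) := by
    unfold jgRO at h2
    rcases hl with hl | hl <;>
    rcases h2 with h2 | h2 | h2 | h2 | h2 | h2 | ⟨h6, h7, h8, h2 | h2 | h2 | h2 | h2 | h2 | h2 | h2⟩ <;> omega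
  clear h2
  unfold jgCP jgCD
  refine ⟨by omega, ?_, ?_, by omega⟩
  · rintro ⟨ha, hb⟩
    omega
  · rintro ⟨ha, hb⟩
    omega

set_option maxHeartbeats 8000000 in
theorem jg_layoutCO {m1 s p e k4 k5 : ℕ} (h1 : 9 ≤ m1) (hs : 7 ≤ s) (he : e ≤ 1) (hpe : 1 ≤ p + e)
    (hpm : p + e ≤ m1) (hp : p < m1) (hpar : s % 2 = 1) (hparm : m1 % 2 = 1)
    (hk : (e = 1 ∧ p % 2 = 1 ∧ k5 = p + 1 ∧ k4 = p) ∨ (e = 1 ∧ p % 2 = 0 ∧ k5 = p ∧ k4 = p + 1) ∨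
      (e = 0 ∧ k5 = p ∧ k4 = p)) :
    ∃ (D : Finset (ℕ × ℕ)) (π y : ℕ × ℕ → ℕ × ℕ) (P : Finset (ℕ × ℕ)) (x1 x2 y1 y2 : ℕ × ℕ),
      #P ≤ 8 ∧ JgBase m1 (s + 2) (m1 * s + (p + e) + p) D π y P x1 x2 y1 y2 := by
  obtain ⟨f, hf⟩ : ∃ f : ℕ → ℕ → ℕ, f = fun x y =>
      if y = 5 ∧ x < k5 then (if x % 2 = 1 then x - 1 else if x + 1 < k5 then x + 1 else x)
      else if y = 4 ∧ k4 ≤ x then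
        (if (x + k4) % 2 = 1 then x - 1 else if x + 1 < m1 then x + 1 else x)
      else x := ⟨_, rfl⟩
  obtain ⟨g, hg⟩ : ∃ g : ℕ → ℕ → ℕ, g = fun x y =>
      if y = 5 ∧ x < k5 then 5
      else if y = 4 ∧ k4 ≤ x then 4
      else if x < p then
        if y = 0 then s + 1 else if y = s + 1 then 0
        else if (y % 2 = 1 ∧ y ≤ 4) ∨ (y % 2 = 0 ∧ 4 < y) then y + 1 else y - 1
      else if x < p + e ∨ y < 4 then (if y % 2 = 0 then y + 1 else y - 1)
      else if y % 2 = 1 then y + 1 else y - 1 := ⟨_, rfl⟩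
  have spec : ∀ x y, jgRO m1 s p e k4 k5 x y (f x y) (g x y) := fun x y =>
    jgRO_spec m1 s p e k4 k5 x y _ _ he hs hk (by rw [hf]) (by rw [hg])
  clear hf hg
  have hmem : ∀ x y, jgCD m1 s p e x y → jgCD m1 s p e (f x y) (g x y) := fun x y h =>
    jgRO_mem h1 hs he hpe hpm hp hpar hparm hk x y _ _ h (spec x y)
  have hinv : ∀ x y, jgCD m1 s p e x y →
      f (f x y) (g x y) = x ∧ g (f x y) (g x y) = y := fun x y h =>
    jgRO_inv h1 hs he hpe hpm hp hpar hparm hk x y _ _ _ _ h (spec x y) (spec _ _)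
  have hadj : ∀ x y, jgCD m1 s p e x y → (f x y = x ∧ g x y = y) ∨
      jgAdj m1 (s + 2) (x, y) (f x y, g x y) := fun x y h =>
    jgRO_adj h1 hs he hpe hpm hp hpar hparm hk x y _ _ h (spec x y)
  have hPP : ∀ x y, jgCP m1 s p e x y → ¬ jgCP m1 s p e (f x y) (g x y) := fun x y h h5 =>
    jgRO_PP h1 hs he hpe hpm hp hpar hparm hk x y _ _ h h5 (spec x y)
  have hloc : ∀ x y, jgCD m1 s p e x y → f x y = x → g x y = y → e = 0 ∧
      ((y = 5 ∧ p % 2 = 1 ∧ x + 1 = p) ∨ (y = 4 ∧ p % 2 = 0 ∧ x + 1 = m1)) := by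
    intro x y h h3 h4
    have h2 := spec x y
    rw [h3, h4] at h2
    exact jgRO_loc h1 hs he hpe hpm hp hpar hparm hk x y h h2
  have hfix : ∀ x y, jgCD m1 s p e x y → f x y = x → g x y = y →
      (1 ≤ y ∧ y ≤ 5 ∧ x < m1) ∧ ¬ jgCP m1 s p e x (y - 1) ∧
      ¬ jgCP m1 s p e (f x (y - 1)) (g x (y - 1)) ∧
      (f x (y - 1) = x → g x (y - 1) = y - 1 → False) := by
    intro x y h h3 h4
    have hl := hloc x y h h3 h4
    exact jgRO_fix h1 hs he hpe hpm hp hpar hparm hk x y _ _ hl.1 hl.2 (spec x (y - 1))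
  have huniq : ∀ x y x' y', jgCD m1 s p e x y → jgCD m1 s p e x' y' → f x y = x → g x y = y →
      f x' y' = x' → g x' y' = y' → x = x' ∧ y = y' := by
    intro x y x' y' h h' h3 h4 h5 h6
    have hl := hloc x y h h3 h4
    have hl' := hloc x' y' h' h5 h6
    omega
  by_cases hp2 : 2 ≤ p
  · have e1 : f 0 3 = 0 ∧ g 0 3 = 4 := by
      have h2 := spec 0 3
      unfold jgRO at h2
      omega
    have e2 : f 0 2 = 0 ∧ g 0 2 = 1 := by
      have h2 := spec 0 2
      unfold jgRO at h2
      omega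
    have e3 : f 0 5 = 1 ∧ g 0 5 = 5 := by
      have h2 := spec 0 5
      unfold jgRO at h2
      omega
    refine jg_layoutC h1 hs he hpe hpm hp f g hmem hinv hadj hPP hfix huniq
      0 3 0 4 0 2 0 5 ?_ e1 ?_ ?_ ?_ ?_ ?_ (Or.inl ⟨rfl, Or.inr (Or.inl rfl)⟩)
      (Or.inl ⟨rfl, Or.inl rfl⟩) ?_ ?_ ?_ ?_ ?_ ?_ ?_
    all_goals try (unfold jgCP jgCD; omega)
    all_goals try (unfold jgCD; omega)
    all_goals try omega
    intro x y h h3 h4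
    have hl := hloc x y h h3 h4
    omega
  · obtain ⟨k, hkk⟩ : ∃ k, k = p + e := ⟨_, rfl⟩
    have e1 : f k 2 = k ∧ g k 2 = 3 := by
      have h2 := spec k 2
      unfold jgRO at h2
      omega
    have e2 : f (k + 1) 2 = k + 1 ∧ g (k + 1) 2 = 3 := by
      have h2 := spec (k + 1) 2
      unfold jgRO at h2
      omega
    have e3 : (f k 4 = k + 1 ∨ (f k 4 + 1 = k ∧ e = 1)) ∧ g k 4 = 4 := by
      have h2 := spec k 4
      unfold jgRO at h2
      omega
    refine jg_layoutC h1 hs he hpe hpm hp f g hmem hinv hadj hPP hfix huniq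
      k 2 k 3 (k + 1) 2 k 4 ?_ e1 ?_ ?_ ?_ ?_ ?_ (Or.inr ⟨rfl, Or.inl rfl⟩)
      (Or.inl ⟨rfl, Or.inl rfl⟩) ?_ ?_ ?_ ?_ ?_ ?_ ?_
    all_goals try (unfold jgCP jgCD; omega)
    all_goals try (unfold jgCD; omega)
    all_goals try omega
    intro x y h h3 h4
    have hl := hloc x y h h3 h4
    omega


theorem jg_existsC {m1 m2 n : ℕ} (h1 : 9 ≤ m1) (h2 : 9 ≤ m2) (hpar : m2 % 2 = 0 ∨ m1 % 2 = 1)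
    (hn : m1 * (m2 - 2) < n) (hn2 : n < m1 * m2) :
    ∃ (D : Finset (ℕ × ℕ)) (π y : ℕ × ℕ → ℕ × ℕ) (P : Finset (ℕ × ℕ)) (x1 x2 y1 y2 : ℕ × ℕ),
      #P ≤ 8 ∧ JgBase m1 m2 n D π y P x1 x2 y1 y2 := by
  obtain ⟨s, rfl⟩ : ∃ s, m2 = s + 2 := ⟨m2 - 2, by omega⟩
  rw [Nat.add_sub_cancel] at hn
  rw [Nat.mul_add] at hn2
  obtain ⟨a, rfl⟩ : ∃ a, n = m1 * s + a := ⟨n - m1 * s, by omega⟩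
  obtain ⟨p, e, he, rfl⟩ : ∃ p e, e ≤ 1 ∧ a = (p + e) + p := ⟨a / 2, a % 2, by omega, by omega⟩
  rw [← Nat.add_assoc]
  by_cases hs : s % 2 = 0
  · exact jg_layoutCE h1 (by omega) he (by omega) (by omega) (by omega) hs
  · have hm : m1 % 2 = 1 := by omega
    by_cases h0 : e = 0
    · exact jg_layoutCO (k4 := p) (k5 := p) h1 (by omega) he (by omega) (by omega) (by omega)
        (by omega) hm (by omega)
    · by_cases hp : p % 2 = 1
      · exact jg_layoutCO (k4 := p) (k5 := p + 1) h1 (by omega) he (by omega) (by omega) (by omega)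
          (by omega) hm (by omega)
      · exact jg_layoutCO (k4 := p + 1) (k5 := p) h1 (by omega) he (by omega) (by omega) (by omega)
          (by omega) hm (by omega)

open Classical in
theorem jg_core {A T : Type*} [Fintype A] [Fintype T] (m1 m2 : ℕ) (h1 : 9 ≤ m1) (h2 : 9 ≤ m2)
    (hpar : m2 % 2 = 0 ∨ m1 % 2 = 1)
    (hVA : Fintype.card A < m1 * m2)
    (t : A → T) (ht : Function.Surjective t) (hT : 3 ≤ Fintype.card T)
    (hbig : ∃ c : T, 8 ≤ typeCount t c) :
    ∃ σ : A → ℕ × ℕ, JgNG m1 m2 t σ := by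
  obtain ⟨c, hc⟩ := hbig
  have hcount : typeCount t c = #{a : A | t a = c} := by
    rw [typeCount, Set.ncard_eq_toFinset_card']
    congr 1
    ext a
    simp
  obtain ⟨r0, -, hr0⟩ := Finset.exists_max_image (Finset.univ : Finset T)
    (fun c => #{a : A | t a = c}) ⟨c, Finset.mem_univ _⟩
  have hmax : ∀ c, #{a : A | t a = c} ≤ #{a : A | t a = r0} := fun c => hr0 c (Finset.mem_univ _)
  have h8 : 8 ≤ #{a : A | t a = r0} := by
    rw [hcount] at hc
    exact hc.trans (hmax c)
  have hpos : 1 ≤ #{a : A | t a ≠ r0} := by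
    have : Nontrivial T := Fintype.one_lt_card_iff_nontrivial.1 (by omega)
    obtain ⟨d, hd⟩ := exists_ne r0
    obtain ⟨a, rfl⟩ := ht d
    exact Finset.card_pos.2 ⟨a, by simp [hd]⟩
  have hsum : #{a : A | t a = r0} + #{a : A | t a ≠ r0} = Fintype.card A := by
    rw [← Finset.card_univ, ← Finset.card_filter_add_card_filter_not
      (s := (Finset.univ : Finset A)) (fun a => t a = r0)]
  by_cases hb : #{a : A | t a ≠ r0} + 4 ≤ #{a : A | t a = r0}
  · exact jg_case2 t r0 m1 m2 h1 h2 hVA hb hpos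
  · by_cases hn : Fintype.card A ≤ m1 * (m2 - 2)
    · obtain ⟨D, π, y, P, x1, x2, y1, y2, hP, L⟩ :=
        jg_existsA (n := Fintype.card A) h1 h2 (by omega) hn
      exact jg_case1 t r0 L (Or.inl hP) hmax h8 (by omega)
    · obtain ⟨D, π, y, P, x1, x2, y1, y2, hP, L⟩ :=
        jg_existsC (n := Fintype.card A) h1 h2 hpar (by omega) hVA
      have h63 : 9 * 7 ≤ m1 * (m2 - 2) := Nat.mul_le_mul h1 (by omega)
      exact jg_case1 t r0 L (Or.inr ⟨hP, by omega⟩) hmax h8 (by omega)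

/-- Every jump game on an m₁ × m₂ torus with m₁ ≥ m₂ ≥ 9, with
n < m₁·m₂ agents partitioned into k ≥ 3 types, whose largest type has at least
8 agents, admits an equilibrium assignment. -/
theorem stmt_8 {A T : Type*} [Fintype A] [Fintype T]
    (m₁ m₂ : ℕ) (h₂ : 9 ≤ m₂) (h₁ : m₂ ≤ m₁)
    (hA : 2 ≤ Fintype.card A) (hVA : Fintype.card A < m₁ * m₂)
    (t : A → T) (ht : Function.Surjective t) (hT : 3 ≤ Fintype.card T)
    (hbig : ∃ c : T, 8 ≤ typeCount t c) :
    ∃ σ : A ↪ ZMod m₁ × ZMod m₂, IsEquilibrium (torusGraph m₁ m₂) t σ := by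
  rcases Nat.mod_two_eq_zero_or_one m₂ with h | h
  · obtain ⟨σ, hσ⟩ := jg_core m₁ m₂ (h₂.trans h₁) h₂ (Or.inl h) hVA t ht hT hbig
    exact jg_equilibrium (h₂.trans h₁) h₂ hσ
  · obtain ⟨σ, hσ⟩ := jg_core m₂ m₁ h₂ (h₂.trans h₁) (Or.inr h) (by rwa [Nat.mul_comm]) t ht hT hbig
    exact jg_equilibrium (h₂.trans h₁) h₂ (jgNG_swap hσ)
end

section
/- For every ε > 0 there exists a jump game (on a finite simple connected graph) that admits at least one equilibrium assignment and in which: (a) there is an assignment w such that every equilibrium assignment v satisfies SW(w) ≥ (3/2 − ε)·SW(v); and (b) there is an assignment w' such that every equilibrium assignment v satisfies CE(w') ≥ (3/2 − ε)·CE(v). Consequently, the price of stability with respect to the social welfare and with respect to the number of colorful edges is at least 3/2 − ε for every ε > 0. -/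
open Finset

variable {V : Type*} {A : Type*} {T : Type*}

/-! The game: two hubs `0`, `1` joined to the nine nodes `4..12`, and a path `0 - 2 - 3 - 1`.
Twelve agents: one of type `0`, one of type `1`, ten of type `2`. -/

/-- Adjacency, as a bit table. -/
def adjB (x y : Fin 13) : Bool := Nat.testBit 274065012201229017502241472720328498559944957940 (13 * x.val + y.val)

def theG : SimpleGraph (Fin 13) where
  Adj x y := adjB x y = true
  symm := ⟨by decide +kernel⟩
  loopless := ⟨by decide +kernel⟩

def theT (i : Fin 12) : Fin 3 := if i = 0 then 0 else if i = 1 then 1 else 2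

/-- `x` has a type-2 neighbour when red, green, hole are at `r g e`. -/
def hasBlue (r g e x : Fin 13) : Bool :=
  decide (∃ y, adjB x y = true ∧ y ≠ r ∧ y ≠ g ∧ y ≠ e)

def U0 (r g e x : Fin 13) : ℕ := (adjB x g).toNat + (hasBlue r g e x).toNat
def U1 (r g e x : Fin 13) : ℕ := (adjB x r).toNat + (hasBlue r g e x).toNat
def U2 (r g x : Fin 13) : ℕ := (adjB x r).toNat + (adjB x g).toNat

def blueSum (r g e : Fin 13) : ℕ :=
  ∑ x, if x ≠ r ∧ x ≠ g ∧ x ≠ e then U2 r g x else 0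

def eqProp (r g e : Fin 13) : Prop :=
  U0 r g e e ≤ U0 r g e r ∧ U1 r g e e ≤ U1 r g e g ∧
    ∀ x, x ≠ r ∧ x ≠ g ∧ x ≠ e → U2 r g e ≤ U2 r g x

instance (r g e : Fin 13) : Decidable (eqProp r g e) := by unfold eqProp; infer_instance

theorem key : ∀ r g e : Fin 13, r ≠ g → r ≠ e → g ≠ e → eqProp r g e →
    U0 r g e r + U1 r g e g + blueSum r g e ≤ 14 ∧
    (adjB r g).toNat + blueSum r g e ≤ 11 := by
  decide +kernel

theorem key_eq : eqProp 0 2 1 := by decide +kernel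

theorem key_w : U0 0 1 3 0 + U1 0 1 3 1 + blueSum 0 1 3 = 21 := by decide +kernel

/-- generic utility -/
noncomputable def gU (σ : Fin 12 ↪ Fin 13) (c : Fin 3) (x : Fin 13) : ℕ :=
  {d : Fin 3 | d ≠ c ∧ ∃ j, theG.Adj x (σ j) ∧ theT j = d}.ncard

theorem util_eq (σ : Fin 12 ↪ Fin 13) (i : Fin 12) : util theG theT σ i = gU σ (theT i) (σ i) := rfl

theorem util_jump (σ σ' : Fin 12 ↪ Fin 13) (i : Fin 12) (h : ∀ j, j ≠ i → σ' j = σ j) :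
    util theG theT σ' i = gU σ (theT i) (σ' i) := by
  unfold util gU
  congr 1
  ext d
  simp only [Set.mem_setOf_eq]
  refine and_congr_right fun hd => exists_congr fun j => ?_
  constructor
  · rintro ⟨h1, h2⟩
    have : j ≠ i := by rintro rfl; exact hd h2.symm
    rw [h j this] at h1; exact ⟨h1, h2⟩
  · rintro ⟨h1, h2⟩
    have : j ≠ i := by rintro rfl; exact hd h2.symm
    rw [h j this]; exact ⟨h1, h2⟩

theorem theT_zero (j : Fin 12) : theT j = 0 ↔ j = 0 := by revert j; decide
theorem theT_one (j : Fin 12) : theT j = 1 ↔ j = 1 := by revert j; decide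
theorem theT_two (j : Fin 12) : theT j = 2 ↔ j ≠ 0 ∧ j ≠ 1 := by revert j; decide

/-- The unique hole. -/
def Hole (σ : Fin 12 ↪ Fin 13) (e : Fin 13) : Prop := ∀ x, x ≠ e ↔ ∃ j, σ j = x

theorem exists_hole (σ : Fin 12 ↪ Fin 13) : ∃ e, Hole σ e := by
  have hc : (Finset.univ.map σ)ᶜ.card = 1 := by
    rw [Finset.card_compl, Finset.card_map]; simp
  obtain ⟨e, he⟩ := Finset.card_eq_one.1 hc
  refine ⟨e, fun x => ?_⟩
  have := Finset.ext_iff.1 he x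
  simp only [Finset.mem_compl, Finset.mem_map, Finset.mem_univ, true_and,
    Finset.mem_singleton] at this
  rw [ne_eq, ← this, not_not]

theorem blue_iff {σ : Fin 12 ↪ Fin 13} {e : Fin 13} (he : Hole σ e) (x : Fin 13) :
    (x ≠ σ 0 ∧ x ≠ σ 1 ∧ x ≠ e) ↔ ∃ j, σ j = x ∧ theT j = 2 := by
  constructor
  · rintro ⟨h0, h1, h2⟩
    obtain ⟨j, rfl⟩ := (he x).1 h2
    refine ⟨j, rfl, (theT_two j).2 ⟨?_, ?_⟩⟩
    · rintro rfl; exact h0 rfl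
    · rintro rfl; exact h1 rfl
  · rintro ⟨j, rfl, hj⟩
    rw [theT_two] at hj
    exact ⟨fun h => hj.1 (σ.injective h), fun h => hj.2 (σ.injective h), (he _).2 ⟨j, rfl⟩⟩

theorem near_zero (σ : Fin 12 ↪ Fin 13) (x : Fin 13) :
    (∃ j, theG.Adj x (σ j) ∧ theT j = 0) ↔ adjB x (σ 0) = true := by
  simp [theT_zero, theG]
theorem near_one (σ : Fin 12 ↪ Fin 13) (x : Fin 13) :
    (∃ j, theG.Adj x (σ j) ∧ theT j = 1) ↔ adjB x (σ 1) = true := by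
  simp [theT_one, theG]
theorem near_two {σ : Fin 12 ↪ Fin 13} {e : Fin 13} (he : Hole σ e) (x : Fin 13) :
    (∃ j, theG.Adj x (σ j) ∧ theT j = 2) ↔ hasBlue (σ 0) (σ 1) e x = true := by
  unfold hasBlue
  rw [decide_eq_true_iff]
  simp only [blue_iff he]
  constructor
  · rintro ⟨j, h1, h2⟩; exact ⟨σ j, h1, j, rfl, h2⟩
  · rintro ⟨y, h1, j, rfl, h2⟩; exact ⟨j, h1, h2⟩

theorem ncard_two (a b : Fin 3) (hab : a ≠ b) (p q : Bool) (S : Set (Fin 3))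
    (hS : ∀ d, d ∈ S ↔ (d = a ∧ p = true) ∨ (d = b ∧ q = true)) :
    S.ncard = p.toNat + q.toNat := by
  have : S = {d | (d = a ∧ p = true) ∨ (d = b ∧ q = true)} := Set.ext hS
  subst this
  cases p <;> cases q <;> simp
  exact Set.ncard_pair hab

theorem gU0 {σ : Fin 12 ↪ Fin 13} {e : Fin 13} (he : Hole σ e) (x : Fin 13) :
    gU σ 0 x = U0 (σ 0) (σ 1) e x := by
  refine ncard_two 1 2 (by decide) _ _ _ fun d => ?_
  rw [← near_one, ← near_two he]
  fin_cases d <;> simp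

theorem gU1 {σ : Fin 12 ↪ Fin 13} {e : Fin 13} (he : Hole σ e) (x : Fin 13) :
    gU σ 1 x = U1 (σ 0) (σ 1) e x := by
  refine ncard_two 0 2 (by decide) _ _ _ fun d => ?_
  rw [← near_zero, ← near_two he]
  fin_cases d <;> simp

theorem gU2 (σ : Fin 12 ↪ Fin 13) (x : Fin 13) :
    gU σ 2 x = U2 (σ 0) (σ 1) x := by
  refine ncard_two 0 1 (by decide) _ _ _ fun d => ?_
  rw [← near_zero, ← near_one]
  fin_cases d <;> simp

theorem eq_iff {σ : Fin 12 ↪ Fin 13} {e : Fin 13} (he : Hole σ e) :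
    IsEquilibrium theG theT σ ↔ eqProp (σ 0) (σ 1) e := by
  have hempty : ∀ i, σ i ≠ e := fun i => (he _).2 ⟨i, rfl⟩
  have h1 : IsEquilibrium theG theT σ ↔ ∀ i, gU σ (theT i) e ≤ gU σ (theT i) (σ i) := by
    constructor
    · intro h i
      by_contra hlt
      have hinj : Function.Injective (Function.update σ i e) := by
        intro a b hab
        by_cases ha : a = i <;> by_cases hb : b = i
        · rw [ha, hb]
        · subst ha; simp [Function.update_of_ne hb] at hab
          exact absurd hab.symm (hempty b)
        · subst hb; simp [Function.update_of_ne ha] at hab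
          exact absurd hab (hempty a)
        · simp [Function.update_of_ne ha, Function.update_of_ne hb] at hab
          exact hab
      have hag : ∀ j, j ≠ i → (⟨Function.update σ i e, hinj⟩ : Fin 12 ↪ Fin 13) j = σ j :=
        fun j hj => Function.update_of_ne hj _ _
      have hi : (⟨Function.update σ i e, hinj⟩ : Fin 12 ↪ Fin 13) i = e :=
        Function.update_self _ _ _
      refine h ⟨Function.update σ i e, hinj⟩ i ⟨hag, ?_, ?_⟩
      · rw [hi]; exact hempty
      · rw [util_jump σ _ i hag, hi, util_eq]; exact not_le.1 hlt
    · rintro h σ' i ⟨hag, hem, hlt⟩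
      rw [util_jump σ σ' i hag, util_eq] at hlt
      have : σ' i = e := by
        by_contra hne
        obtain ⟨j, hj⟩ := (he _).1 hne
        exact hem j hj
      rw [this] at hlt
      exact absurd (h i) (not_le.2 hlt)
  rw [h1]
  unfold eqProp
  constructor
  · intro h
    refine ⟨?_, ?_, ?_⟩
    · rw [← gU0 he, ← gU0 he]; exact h 0
    · rw [← gU1 he, ← gU1 he]; exact h 1
    · intro x hx
      obtain ⟨j, rfl, hj⟩ := (blue_iff he x).1 hx
      rw [← gU2, ← gU2, ← hj]; exact h j
  · rintro ⟨h0, h1, h2⟩ i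
    by_cases i0 : i = 0
    · subst i0
      rw [← gU0 he, ← gU0 he] at h0; exact h0
    by_cases i1 : i = 1
    · subst i1
      rw [← gU1 he, ← gU1 he] at h1; exact h1
    have hi := (theT_two i).2 ⟨i0, i1⟩
    have := h2 (σ i) ((blue_iff he _).2 ⟨i, rfl, hi⟩)
    rw [← gU2, ← gU2] at this
    rw [hi]; exact this

theorem sw_eq {σ : Fin 12 ↪ Fin 13} {e : Fin 13} (he : Hole σ e) :
    socialWelfare theG theT σ =
      U0 (σ 0) (σ 1) e (σ 0) + U1 (σ 0) (σ 1) e (σ 1) + blueSum (σ 0) (σ 1) e := by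
  have hb : blueSum (σ 0) (σ 1) e = ∑ i : Fin 12, if theT i = 2 then U2 (σ 0) (σ 1) (σ i) else 0 := by
    unfold blueSum
    rw [← Finset.sum_filter, ← Finset.sum_filter]
    symm
    apply Finset.sum_bij (fun i _ => σ i)
    · intro i hi
      simp only [Finset.mem_filter, Finset.mem_univ, true_and] at hi ⊢
      exact (blue_iff he _).2 ⟨i, rfl, hi⟩
    · intro a _ b _ h; exact σ.injective h
    · intro x hx
      simp only [Finset.mem_filter, Finset.mem_univ, true_and] at hx
      obtain ⟨j, h1, h2⟩ := (blue_iff he _).1 hx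
      exact ⟨j, by simpa using h2, h1⟩
    · intro _ _; rfl
  rw [hb]
  unfold socialWelfare
  simp only [util_eq]
  rw [Fin.sum_univ_succ, Fin.sum_univ_succ, Fin.sum_univ_succ (n := 11), Fin.sum_univ_succ (n := 10)]
  have t0 : theT 0 = 0 := by decide
  have t1 : theT (Fin.succ 0) = 1 := by decide
  have t2 : ∀ i : Fin 10, theT i.succ.succ = 2 := by decide
  simp only [t0, t1, t2, gU0 he, gU1 he, gU2]
  simp [add_assoc]

theorem ce_le {σ : Fin 12 ↪ Fin 13} {e : Fin 13} (he : Hole σ e) :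
    colorfulEdges theG theT σ ≤ (adjB (σ 0) (σ 1)).toNat + blueSum (σ 0) (σ 1) e := by
  classical
  set r := σ 0
  set g := σ 1
  have hbs : blueSum r g e =
      (Finset.univ.filter fun x => (x ≠ r ∧ x ≠ g ∧ x ≠ e) ∧ adjB x r = true).card +
      (Finset.univ.filter fun x => (x ≠ r ∧ x ≠ g ∧ x ≠ e) ∧ adjB x g = true).card := by
    rw [Finset.card_filter, Finset.card_filter, ← Finset.sum_add_distrib]
    unfold blueSum U2
    refine Finset.sum_congr rfl fun x _ => ?_
    by_cases hx : x ≠ r ∧ x ≠ g ∧ x ≠ e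
    · rw [if_pos hx]
      simp only [and_iff_right hx]
      cases adjB x r <;> cases adjB x g <;> simp
    · rw [if_neg hx, if_neg (fun h => hx h.1), if_neg (fun h => hx h.1)]
  have hA : (if adjB r g = true then ({s(r, g)} : Finset (Sym2 (Fin 13))) else ∅).card
      = (adjB r g).toNat := by
    cases adjB r g <;> simp
  rw [hbs, ← hA]
  set P := Finset.univ.filter fun x => (x ≠ r ∧ x ≠ g ∧ x ≠ e) ∧ adjB x r = true with hP
  set Q := Finset.univ.filter fun x => (x ≠ r ∧ x ≠ g ∧ x ≠ e) ∧ adjB x g = true with hQ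
  set R := (if adjB r g = true then ({s(r, g)} : Finset (Sym2 (Fin 13))) else ∅) with hR
  have hsub : {f ∈ theG.edgeSet | ∃ i j : Fin 12, theT i ≠ theT j ∧ f = s(σ i, σ j)} ⊆
      ((R ∪ (P.image (fun x => s(x, r)) ∪ Q.image (fun x => s(x, g))) : Finset _) : Set _) := by
    have main : ∀ i j : Fin 12, theT i < theT j → s(σ i, σ j) ∈ theG.edgeSet →
        s(σ i, σ j) ∈ R ∪ (P.image (fun x => s(x, r)) ∪ Q.image (fun x => s(x, g))) := by
      intro i j hij hadj
      have hadj' : adjB (σ i) (σ j) = true := hadj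
      have hsym : adjB (σ j) (σ i) = true := theG.symm.symm _ _ hadj
      by_cases hj : theT j = 2
      · have hbj := (blue_iff he (σ j)).2 ⟨j, rfl, hj⟩
        have : theT i = 0 ∨ theT i = 1 := by
          rw [hj] at hij; revert hij; generalize theT i = a; revert a; decide
        rcases this with hi | hi
        · rw [theT_zero] at hi; subst hi
          apply Finset.mem_union_right
          apply Finset.mem_union_left
          rw [Finset.mem_image]
          exact ⟨σ j, by simp only [hP, Finset.mem_filter, Finset.mem_univ, true_and]; exact ⟨hbj, hsym⟩, Sym2.eq_swap⟩
        · rw [theT_one] at hi; subst hi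
          apply Finset.mem_union_right
          apply Finset.mem_union_right
          rw [Finset.mem_image]
          exact ⟨σ j, by simp only [hQ, Finset.mem_filter, Finset.mem_univ, true_and]; exact ⟨hbj, hsym⟩, Sym2.eq_swap⟩
      · have : theT i = 0 ∧ theT j = 1 := by
          revert hij hj; generalize theT i = a; generalize theT j = b; revert a b; decide
        obtain ⟨h1, h2⟩ := this
        rw [theT_zero] at h1; rw [theT_one] at h2
        subst h1 h2
        apply Finset.mem_union_left
        have hrg : adjB r g = true := hadj'
        rw [hR, if_pos hrg]; exact Finset.mem_singleton_self _
    rintro f ⟨hf, i, j, hne, rfl⟩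
    rw [Finset.mem_coe]
    rcases lt_or_gt_of_ne hne with h | h
    · exact main i j h hf
    · rw [Sym2.eq_swap] at hf ⊢
      exact main j i h hf
  unfold colorfulEdges
  refine (Set.ncard_le_ncard hsub (Finset.finite_toSet _)).trans ?_
  rw [Set.ncard_coe_finset]
  refine (Finset.card_union_le _ _).trans (Nat.add_le_add_left ?_ _)
  exact (Finset.card_union_le _ _).trans (Nat.add_le_add Finset.card_image_le Finset.card_image_le)

def optW : Fin 12 ↪ Fin 13 := Fin.succAboveEmb 3
def eqW : Fin 12 ↪ Fin 13 := Fin.succAboveEmb 1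

theorem hole_optW : Hole optW 3 := by
  unfold Hole; decide +kernel
theorem hole_eqW : Hole eqW 1 := by
  unfold Hole; decide +kernel

theorem ce_optW : 17 ≤ colorfulEdges theG theT optW := by
  classical
  have hinj : Function.Injective (fun p : Fin 2 × Fin 9 =>
      (s(Fin.castLE (by decide) p.1, Fin.natAdd 4 p.2) : Sym2 (Fin 13))) := by
    decide +kernel
  have hsub : Set.range (fun p : Fin 2 × Fin 9 =>
      (s(Fin.castLE (by decide) p.1, Fin.natAdd 4 p.2) : Sym2 (Fin 13))) ⊆
      {f ∈ theG.edgeSet | ∃ i j : Fin 12, theT i ≠ theT j ∧ f = s(optW i, optW j)} := by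
    rintro _ ⟨⟨a, b⟩, rfl⟩
    have h1 : ∀ (a : Fin 2) (b : Fin 9),
      adjB (Fin.castLE (by decide) a) (Fin.natAdd 4 b) = true := by decide +kernel
    have h2 : ∀ (a : Fin 2), optW (Fin.castLE (by decide) a) = Fin.castLE (by decide) a := by
      decide +kernel
    have h3 : ∀ (b : Fin 9), optW (Fin.natAdd 3 b) = Fin.natAdd 4 b := by decide +kernel
    have h4 : ∀ (a : Fin 2) (b : Fin 9),
      theT (Fin.castLE (by decide) a) ≠ theT (Fin.natAdd 3 b) := by decide +kernel
    refine ⟨h1 a b, Fin.castLE (by decide) a, Fin.natAdd 3 b, h4 a b, ?_⟩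
    rw [h2, h3]
  unfold colorfulEdges
  refine le_trans ?_ (Set.ncard_le_ncard hsub (Set.toFinite _))
  rw [← Set.image_univ, Set.ncard_image_of_injective _ hinj, Set.ncard_univ]
  simp

theorem theG_conn : theG.Connected := by
  have h0 : ∀ x, theG.Reachable 0 x := by
    have h2 : theG.Adj 0 2 := by show adjB _ _ = true; decide +kernel
    have h3 : theG.Adj 2 3 := by show adjB _ _ = true; decide +kernel
    have h1 : theG.Adj 3 1 := by show adjB _ _ = true; decide +kernel
    have hx : ∀ x : Fin 13, x = 0 ∨ x = 1 ∨ x = 2 ∨ x = 3 ∨ adjB 0 x = true := by decide +kernel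
    intro x
    rcases hx x with rfl | rfl | rfl | rfl | h
    · exact SimpleGraph.Reachable.refl _
    · exact (h2.reachable.trans h3.reachable).trans h1.reachable
    · exact h2.reachable
    · exact h2.reachable.trans h3.reachable
    · exact SimpleGraph.Adj.reachable h
  exact { preconnected := fun x y => (h0 x).symm.trans (h0 y), nonempty := ⟨0⟩ }

theorem eq_bound (v : Fin 12 ↪ Fin 13) (hv : IsEquilibrium theG theT v) :
    socialWelfare theG theT v ≤ 14 ∧ colorfulEdges theG theT v ≤ 11 := by
  obtain ⟨e, he⟩ := exists_hole v
  have h := key (v 0) (v 1) e (fun h => absurd (v.injective h) (by decide))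
    ((he _).2 ⟨0, rfl⟩) ((he _).2 ⟨1, rfl⟩) ((eq_iff he).1 hv)
  rw [sw_eq he]
  exact ⟨h.1, (ce_le he).trans h.2⟩

/-- For every ε > 0 there is a jump game admitting an equilibrium
in which some assignment `w` satisfies `SW(w) ≥ (3/2 − ε)·SW(v)` for every
equilibrium `v`, and some assignment `w'` satisfies
`CE(w') ≥ (3/2 − ε)·CE(v)` for every equilibrium `v`; hence the price of
stability w.r.t. both objectives is at least 3/2 − ε. -/
theorem stmt_19 (ε : ℝ) (hε : 0 < ε) :
    ∃ (nA nV k : ℕ) (G : SimpleGraph (Fin nV)) (t : Fin nA → Fin k),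
      2 ≤ nA ∧ nA < nV ∧ G.Connected ∧ 2 ≤ k ∧ Function.Surjective t ∧
      (∃ σ : Fin nA ↪ Fin nV, IsEquilibrium G t σ) ∧
      (∃ w : Fin nA ↪ Fin nV, ∀ v : Fin nA ↪ Fin nV, IsEquilibrium G t v →
          (3 / 2 - ε) * (socialWelfare G t v : ℝ) ≤ (socialWelfare G t w : ℝ)) ∧
      (∃ w' : Fin nA ↪ Fin nV, ∀ v : Fin nA ↪ Fin nV, IsEquilibrium G t v →
          (3 / 2 - ε) * (colorfulEdges G t v : ℝ) ≤ (colorfulEdges G t w' : ℝ)) := by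
  refine ⟨12, 13, 3, theG, theT, by norm_num, by norm_num, theG_conn, by norm_num, by decide,
    ⟨eqW, (eq_iff hole_eqW).2 key_eq⟩, ⟨optW, fun v hv => ?_⟩, ⟨optW, fun v hv => ?_⟩⟩
  · have h1 : (socialWelfare theG theT v : ℝ) ≤ 14 := by exact_mod_cast (eq_bound v hv).1
    have h2 : (socialWelfare theG theT optW : ℝ) = 21 := by
      have : socialWelfare theG theT optW = 21 := (sw_eq hole_optW).trans key_w
      exact_mod_cast this
    have h0 : (0 : ℝ) ≤ (socialWelfare theG theT v : ℝ) := Nat.cast_nonneg _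
    rw [h2]
    nlinarith [mul_nonneg hε.le h0]
  · have h1 : (colorfulEdges theG theT v : ℝ) ≤ 11 := by exact_mod_cast (eq_bound v hv).2
    have h2 : (17 : ℝ) ≤ (colorfulEdges theG theT optW : ℝ) := by exact_mod_cast ce_optW
    have h0 : (0 : ℝ) ≤ (colorfulEdges theG theT v : ℝ) := Nat.cast_nonneg _
    nlinarith [mul_nonneg hε.le h0]
end
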